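/- arXiv:math/0001106 — 7 statements merged into one kernel-verified Lean document; each statement's English description precedes it below -/
import Mathlib

section
/- Let Δ ⊆ ℝ^n be a polytope containing the origin 0 in its interior and let V be a vertex of Δ. Then there exists an affinely independent subset S of the vertex set of Δ with V ∈ S such that 0 lies in the relative interior of the convex hull of S; that is, every vertex of Δ belongs to an IP simplex spanned by vertices of Δ. -/
/-- A combination with positive weights of an affinely independent finite set lies in the
intrinsic interior of the convex hull. -/
theorem AffineIndependent.sum_smul_mem_intrinsicInterior_convexHull {E : Type*}
    [NormedAddCommGroup E] [NormedSpace ℝ E] {T : Finset E}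
    (hT : AffineIndependent ℝ ((↑) : ↥(T : Set E) → E)) (w : E → ℝ)
    (hpos : ∀ v ∈ T, 0 < w v) (hsum : ∑ v ∈ T, w v = 1) :
    ∑ v ∈ T, w v • v ∈ intrinsicInterior ℝ (convexHull ℝ (T : Set E)) := by
  have hne : T.Nonempty := by
    rw [Finset.nonempty_iff_ne_empty]
    rintro rfl
    simp at hsum
  have : Nonempty (T : Set E) := hne.coe_sort
  rw [intrinsicInterior, affineSpan_convexHull]
  have : Nonempty (affineSpan ℝ (T : Set E)) := inferInstance
  let p : ↥(T : Set E) → affineSpan ℝ (T : Set E) := fun v => ⟨v, subset_affineSpan ℝ _ v.2⟩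
  have hp : AffineIndependent ℝ p :=
    AffineIndependent.of_comp (affineSpan ℝ (T : Set E)).subtype hT
  have hrange : Set.range p = (↑) ⁻¹' (T : Set E) := by
    ext x
    constructor
    · rintro ⟨v, rfl⟩
      exact v.2
    · intro hx
      exact ⟨⟨x, hx⟩, rfl⟩
  have hspan : affineSpan ℝ (Set.range p) = ⊤ := by
    rw [hrange]
    exact affineSpan_coe_preimage_eq_top (k := ℝ) (T : Set E)
  let b : AffineBasis (T : Set E) ℝ (affineSpan ℝ (T : Set E)) := ⟨p, hp, hspan⟩
  have hfin : FiniteDimensional ℝ (affineSpan ℝ (T : Set E)).direction := b.finiteDimensional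
  have hcoe : ∀ u : ↥(T : Set E) → ℝ, ∑ v, u v = 1 →
      ((Finset.univ.affineCombination ℝ b u : affineSpan ℝ (T : Set E)) : E)
        = ∑ v : (T : Set E), u v • (v : E) := by
    intro u hu
    have := Finset.univ.map_affineCombination b u hu (affineSpan ℝ (T : Set E)).subtype
    refine this.trans ?_
    exact Finset.affineCombination_eq_linear_combination _ _ _ hu
  have hw1 : ∑ v : (T : Set E), w v = 1 := by
    rw [← hsum]
    exact Finset.sum_coe_sort T w
  refine ⟨Finset.univ.affineCombination ℝ b (fun v => w v), ?_, ?_⟩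
  · rw [mem_interior]
    refine ⟨⋂ v, {x | 0 < b.coord v x}, ?_, ?_, ?_⟩
    · intro x hx
      rw [Set.mem_iInter] at hx
      have h1 := b.sum_coord_apply_eq_one x
      have h2 := hcoe _ h1
      rw [b.affineCombination_coord_eq_self] at h2
      change (x : E) ∈ convexHull ℝ (T : Set E)
      rw [h2]
      exact (convex_convexHull ℝ _).sum_mem (fun v _ => (hx v).le) h1
        fun v _ => subset_convexHull ℝ _ v.2
    · exact isOpen_iInter_of_finite fun v =>
        isOpen_lt continuous_const (b.coord v).continuous_of_finiteDimensional
    · rw [Set.mem_iInter]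
      intro v
      change 0 < b.coord v _
      rw [b.coord_apply_combination_of_mem (Finset.mem_univ v) hw1]
      exact hpos v v.2
  · rw [hcoe _ hw1]
    exact Finset.sum_coe_sort T fun v => w v • v

/-- If `0` is a nonnegative combination of `T` with positive weight at `V`, then it is a positive
combination of an affinely independent subset of `T` containing `V`. -/
theorem exists_affineIndependent_pos_sum_smul_eq_zero {E : Type*} [AddCommGroup E] [Module ℝ E]
    {V : E} (T : Finset E) (hV : V ∈ T) (w : E → ℝ) (hw : ∀ v ∈ T, 0 ≤ w v) (hwV : 0 < w V)
    (h0 : ∑ v ∈ T, w v • v = 0) :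
    ∃ S ⊆ T, V ∈ S ∧ AffineIndependent ℝ ((↑) : ↥(S : Set E) → E) ∧
      ∃ u : E → ℝ, (∀ v ∈ S, 0 < u v) ∧ ∑ v ∈ S, u v • v = 0 := by
  classical
  induction T using Finset.strongInduction generalizing w with
  | H T ih =>
    have drop : ∀ u : E → ℝ, (∀ v ∈ T, 0 ≤ u v) → 0 < u V → ∑ v ∈ T, u v • v = 0 →
        (∃ i ∈ T, u i = 0) → ∃ S ⊆ T, V ∈ S ∧ AffineIndependent ℝ ((↑) : ↥(S : Set E) → E) ∧
          ∃ u : E → ℝ, (∀ v ∈ S, 0 < u v) ∧ ∑ v ∈ S, u v • v = 0 := by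
      rintro u hu huV hu0 ⟨i, hi, hui⟩
      have hVi : V ≠ i := by
        rintro rfl
        exact huV.ne' hui
      obtain ⟨S, hST, hS⟩ := ih (T.erase i) (Finset.erase_ssubset hi)
        (Finset.mem_erase.2 ⟨hVi, hV⟩) u (fun v hv => hu v (Finset.mem_of_mem_erase hv)) huV
        (by rw [Finset.sum_erase _ (by rw [hui, zero_smul]), hu0])
      exact ⟨S, hST.trans (Finset.erase_subset _ _), hS⟩
    by_cases hz : ∃ i ∈ T, w i = 0
    · exact drop w hw hwV h0 hz
    by_cases hT : AffineIndependent ℝ ((↑) : ↥(T : Set E) → E)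
    · push Not at hz
      exact ⟨T, subset_rfl, hV, hT, w, fun v hv => (hw v hv).lt_of_ne' (hz v hv), h0⟩
    obtain ⟨g, hg0, hgsum, hgV, hgne⟩ : ∃ g : E → ℝ, ∑ e ∈ T, g e • e = 0 ∧ ∑ e ∈ T, g e = 0 ∧
        g V ≤ 0 ∧ ∃ x ∈ T, g x ≠ 0 := by
      obtain ⟨g, hg0, hgsum, hgne⟩ := exists_nontrivial_relation_sum_zero_of_not_affine_ind hT
      rcases le_total (g V) 0 with h | h
      · exact ⟨g, hg0, hgsum, h, hgne⟩
      · exact ⟨-g, by simp [hg0], by simp [hgsum], by simpa using h, by simpa using hgne⟩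
    obtain ⟨x, hx, hgx⟩ := Finset.exists_pos_of_sum_zero_of_exists_nonzero g hgsum hgne
    obtain ⟨i, hi, hmin⟩ := (T.filter fun z => 0 < g z).exists_min_image (fun z => w z / g z)
      ⟨x, Finset.mem_filter.2 ⟨hx, hgx⟩⟩
    obtain ⟨hiT, hgi⟩ := Finset.mem_filter.1 hi
    have hc : 0 ≤ w i / g i := div_nonneg (hw i hiT) hgi.le
    refine drop (fun z => w z - w i / g i * g z) ?_ ?_ ?_ ⟨i, hiT, ?_⟩
    · intro v hv
      rcases lt_or_ge 0 (g v) with h | h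
      · exact sub_nonneg.2 ((le_div_iff₀ h).1 (hmin v (Finset.mem_filter.2 ⟨hv, h⟩)))
      · exact sub_nonneg.2 ((mul_nonpos_of_nonneg_of_nonpos hc h).trans (hw v hv))
    · exact sub_pos.2 ((mul_nonpos_of_nonneg_of_nonpos hc hgV).trans_lt hwV)
    · simp only [sub_smul, mul_smul, Finset.sum_sub_distrib, ← Finset.smul_sum, hg0, h0, smul_zero,
        sub_zero]
    · simp [hgi.ne']

/-- The convex hull of a finite set is the convex hull of its extreme points. -/
theorem Set.Finite.convexHull_extremePoints_convexHull {E : Type*} [NormedAddCommGroup E]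
    [NormedSpace ℝ E] {F : Set E} (hF : F.Finite) :
    convexHull ℝ ((convexHull ℝ F).extremePoints ℝ) = convexHull ℝ F := by
  have hE : ((convexHull ℝ F).extremePoints ℝ).Finite := hF.subset (extremePoints_convexHull_subset (𝕜 := ℝ))
  have h := closure_convexHull_extremePoints (hF.isCompact_convexHull ℝ) (convex_convexHull ℝ F)
  rwa [(hE.isClosed_convexHull ℝ).closure_eq] at h

/-- Every vertex of a polytope `Δ` with `0` in its interior belongs to an IP simplex
spanned by vertices of `Δ`. -/
theorem stmt_1 (n : ℕ) (F : Set (Fin n → ℝ)) (hF : F.Finite)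
    (h0 : (0 : Fin n → ℝ) ∈ interior (convexHull ℝ F))
    (V : Fin n → ℝ) (hV : V ∈ Set.extremePoints ℝ (convexHull ℝ F)) :
    ∃ S : Set (Fin n → ℝ),
      S ⊆ Set.extremePoints ℝ (convexHull ℝ F) ∧ V ∈ S ∧
      AffineIndependent ℝ ((↑) : S → (Fin n → ℝ)) ∧
      (0 : Fin n → ℝ) ∈ intrinsicInterior ℝ (convexHull ℝ S) := by
  classical
  obtain ⟨T, hT⟩ := (hF.subset (extremePoints_convexHull_subset (𝕜 := ℝ))).exists_finset_coe
  have hVT : V ∈ T := by rwa [← Finset.mem_coe, hT]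
  obtain ⟨ε, hε, hmem⟩ : ∃ ε : ℝ, 0 < ε ∧ -(ε • V) ∈ convexHull ℝ (T : Set (Fin n → ℝ)) := by
    rw [hT, hF.convexHull_extremePoints_convexHull]
    have hcont : Filter.Tendsto (fun ε : ℝ => -(ε • V)) (nhdsWithin 0 (Set.Ioi 0)) (nhds 0) := by
      have : Continuous fun ε : ℝ => -(ε • V) := by fun_prop
      simpa using (this.tendsto 0).mono_left nhdsWithin_le_nhds
    obtain ⟨ε, hε, hpos⟩ :=
      ((hcont.eventually (mem_interior_iff_mem_nhds.1 h0)).and self_mem_nhdsWithin).exists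
    exact ⟨ε, hpos, hε⟩
  obtain ⟨w, hw, -, hsum⟩ := Finset.mem_convexHull'.1 hmem
  obtain ⟨S, hST, hVS, hS, u, hu, hu0⟩ := exists_affineIndependent_pos_sum_smul_eq_zero T hVT
    (fun v => w v + if v = V then ε else 0)
    (fun v hv => add_nonneg (hw v hv) (by split_ifs <;> positivity))
    (by simpa using add_pos_of_nonneg_of_pos (hw V hVT) hε)
    (by simp [add_smul, Finset.sum_add_distrib, hsum, ite_smul, hVT])
  refine ⟨S, hT ▸ Finset.coe_subset.2 hST, hVS, hS, ?_⟩
  have hpos : 0 < ∑ v ∈ S, u v := Finset.sum_pos hu ⟨V, hVS⟩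
  have h := hS.sum_smul_mem_intrinsicInterior_convexHull (fun v => (∑ v ∈ S, u v)⁻¹ * u v)
    (fun v hv => mul_pos (inv_pos.2 hpos) (hu v hv))
    (by rw [← Finset.mul_sum, inv_mul_cancel₀ hpos.ne'])
  simpa only [mul_smul, ← Finset.smul_sum, hu0, smul_zero] using h
end

section
/- Let ∇ ⊆ ℝ^n be a minimal polytope with vertex set 𝒱 of cardinality k. Then either 𝒱 is affinely independent with k = n+1 (∇ is an IP simplex), or there exist a subset 𝒱′ ⊊ 𝒱 with |𝒱′| = k′ and a subset R ⊆ 𝒱′ such that: (1) ∇′ = conv(𝒱′) has some dimension n′ < n, the origin 0 lies in the interior of ∇′ relative to its linear span U′, and for every vertex V of ∇′ the convex hull of the remaining vertices of ∇′ does not contain 0 in its interior relative to U′ (∇′ is a minimal polytope of dimension n′); (2) k − k′ = n − n′ + 1 ≥ 2; (3) S = conv(R ∪ (𝒱 \ 𝒱′)) is an IP simplex, i.e. R ∪ (𝒱 \ 𝒱′) is affinely independent and 0 lies in the relative interior of S; and (4) dim S ≤ n′. -/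
/-- A finite set of vectors is positively dependent if some linear relation between its elements
has strictly positive coefficients. -/
def PosDep {E : Type*} [AddCommGroup E] [Module ℝ E] (s : Finset E) : Prop :=
  ∃ c : E → ℝ, (∀ v ∈ s, 0 < c v) ∧ ∑ v ∈ s, c v • v = 0

section Cone

variable {E F : Type*} [NormedAddCommGroup E] [NormedSpace ℝ E]
  [NormedAddCommGroup F] [NormedSpace ℝ F]

lemma exists_nonneg_sum_eq_of_mem_interior_preimage {s : Finset E} (φ : F →ₗ[ℝ] E)
    (h : (0 : F) ∈ interior (φ ⁻¹' convexHull ℝ (s : Set E))) (x : F) :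
    ∃ b : E → ℝ, (∀ v ∈ s, 0 ≤ b v) ∧ ∑ v ∈ s, b v • v = φ x := by
  have ht : Filter.Tendsto (fun t : ℝ => t • x) (nhdsWithin 0 (Set.Ioi 0)) (nhds 0) := by
    have : Filter.Tendsto (fun t : ℝ => t • x) (nhds 0) (nhds ((0 : ℝ) • x)) :=
      Continuous.tendsto (by fun_prop) 0
    rw [zero_smul] at this
    exact this.mono_left nhdsWithin_le_nhds
  obtain ⟨t, hmem, htpos⟩ :=
    ((ht.eventually (mem_interior_iff_mem_nhds.1 h)).and self_mem_nhdsWithin).exists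
  have htpos : 0 < t := htpos
  obtain ⟨w, hw0, -, hw⟩ := Finset.mem_convexHull'.1 hmem
  refine ⟨fun v => t⁻¹ * w v, fun v hv => mul_nonneg (inv_nonneg.2 htpos.le) (hw0 v hv), ?_⟩
  simp_rw [mul_smul]
  rw [← Finset.smul_sum, hw, map_smul, smul_smul, inv_mul_cancel₀ htpos.ne', one_smul]

lemma zero_mem_interior_convexHull_range [FiniteDimensional ℝ F] {ι : Type*} [Fintype ι]
    [Nonempty ι] {f : ι → F} {c : ι → ℝ} (hc : ∀ i, 0 < c i) (h0 : ∑ i, c i • f i = 0)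
    (hspan : Submodule.span ℝ (Set.range f) = ⊤) :
    (0 : F) ∈ interior (convexHull ℝ (Set.range f)) := by
  have hsum : 0 < ∑ i, c i := Finset.sum_pos (fun i _ => hc i) Finset.univ_nonempty
  have hzero : (0 : F) ∈ convexHull ℝ (Set.range f) := by
    refine mem_convexHull_of_exists_fintype (fun i => (∑ j, c j)⁻¹ * c i) f
      (fun i => mul_nonneg (inv_nonneg.2 hsum.le) (hc i).le) ?_ (fun i => ⟨i, rfl⟩) ?_
    · rw [← Finset.mul_sum, inv_mul_cancel₀ hsum.ne']
    · simp_rw [mul_smul]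
      rw [← Finset.smul_sum, h0, smul_zero]
  have hopen : IsOpenMap (Fintype.linearCombination ℝ f) := by
    refine LinearMap.isOpenMap_of_finiteDimensional _ (LinearMap.range_eq_top.1 ?_)
    rw [Fintype.range_linearCombination, hspan]
  let O : Set (ι → ℝ) := {b | (∀ i, 0 < b i) ∧ ∑ i, b i < 1}
  have hO : IsOpen O := by
    apply IsOpen.and
    · simp only [Set.ofPred_forall]
      exact isOpen_iInter_of_finite fun i => isOpen_lt continuous_const (continuous_apply i)
    · exact isOpen_lt (by fun_prop) continuous_const
  refine mem_interior.2 ⟨Fintype.linearCombination ℝ f '' O, ?_, hopen O hO, ?_⟩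
  · rintro _ ⟨b, ⟨hb, hb1⟩, rfl⟩
    have hbs : 0 < ∑ i, b i := Finset.sum_pos (fun i _ => hb i) Finset.univ_nonempty
    have hmem : ∑ i, ((∑ j, b j)⁻¹ * b i) • f i ∈ convexHull ℝ (Set.range f) :=
      mem_convexHull_of_exists_fintype _ f
        (fun i => mul_nonneg (inv_nonneg.2 hbs.le) (hb i).le)
        (by rw [← Finset.mul_sum, inv_mul_cancel₀ hbs.ne']) (fun i => ⟨i, rfl⟩) rfl
    have := (convex_convexHull ℝ (Set.range f)).starConvex hzero hmem
      (sub_nonneg.2 hb1.le) hbs.le (by ring)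
    simp_rw [mul_smul] at this
    rwa [smul_zero, zero_add, ← Finset.smul_sum, smul_smul, mul_inv_cancel₀ hbs.ne', one_smul,
      ← Fintype.linearCombination_apply] at this
  · refine ⟨fun i => (2 * ∑ j, c j)⁻¹ * c i, ⟨fun i => by have := hc i; positivity, ?_⟩, ?_⟩
    · rw [← Finset.mul_sum, mul_inv, mul_assoc, inv_mul_cancel₀ hsum.ne']
      norm_num
    · simp_rw [Fintype.linearCombination_apply, mul_smul]
      rw [← Finset.smul_sum, h0, smul_zero]

lemma PosDep.zero_mem_interior_convexHull_span [FiniteDimensional ℝ E] {s : Finset E}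
    (hs : PosDep s) (hne : s.Nonempty) :
    (0 : Submodule.span ℝ (s : Set E)) ∈ interior (convexHull ℝ
      (Set.range fun v : s => (⟨v, Submodule.subset_span v.2⟩ : Submodule.span ℝ (s : Set E)))) := by
  obtain ⟨c, hc, h0⟩ := hs
  have : Nonempty s := hne.to_subtype
  refine zero_mem_interior_convexHull_range (c := fun v => c v) (fun v => hc v v.2) ?_ ?_
  · apply Subtype.ext
    rw [← Finset.sum_coe_sort] at h0
    simpa using h0
  · have hrange : (Set.range fun v : s =>
        (⟨v, Submodule.subset_span v.2⟩ : Submodule.span ℝ (s : Set E))) =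
        Subtype.val ⁻¹' (s : Set E) := by
      ext x
      simp [Subtype.ext_iff]
    rw [hrange]
    exact Submodule.span_span_coe_preimage

lemma image_subtype_convexHull_span {s : Finset E} :
    (Submodule.span ℝ (s : Set E)).subtype '' convexHull ℝ
      (Set.range fun v : s => (⟨v, Submodule.subset_span v.2⟩ : Submodule.span ℝ (s : Set E))) =
    convexHull ℝ (s : Set E) := by
  rw [LinearMap.image_convexHull, ← Set.range_comp]
  congr 1
  ext x
  simp

lemma PosDep.zero_mem_interior_preimage [FiniteDimensional ℝ E] {s : Finset E}
    (hs : PosDep s) (hne : s.Nonempty) :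
    (0 : Submodule.span ℝ (s : Set E)) ∈
      interior {x : Submodule.span ℝ (s : Set E) | (x : E) ∈ convexHull ℝ (s : Set E)} := by
  refine interior_mono (fun x hx => ?_) (hs.zero_mem_interior_convexHull_span hne)
  rw [← image_subtype_convexHull_span]
  exact ⟨x, hx, rfl⟩

lemma PosDep.zero_mem_intrinsicInterior [FiniteDimensional ℝ E] {s : Finset E}
    (hs : PosDep s) (hne : s.Nonempty) :
    (0 : E) ∈ intrinsicInterior ℝ (convexHull ℝ (s : Set E)) := by
  rw [← image_subtype_convexHull_span]
  have := AffineIsometry.intrinsicInterior_image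
    (Submodule.span ℝ (s : Set E)).subtypeₗᵢ.toAffineIsometry (convexHull ℝ
      (Set.range fun v : s => (⟨v, Submodule.subset_span v.2⟩ : Submodule.span ℝ (s : Set E))))
  refine this.symm ▸
    ⟨0, interior_subset_intrinsicInterior (hs.zero_mem_interior_convexHull_span hne), rfl⟩

lemma PosDep.zero_mem_interior [FiniteDimensional ℝ E] {s : Finset E} (hs : PosDep s)
    (hne : s.Nonempty) (hspan : Submodule.span ℝ (s : Set E) = ⊤) :
    (0 : E) ∈ interior (convexHull ℝ (s : Set E)) := by
  obtain ⟨c, hc, h0⟩ := hs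
  have : Nonempty s := hne.to_subtype
  have key := zero_mem_interior_convexHull_range (f := fun v : s => (v : E))
    (c := fun v => c v) (fun v => hc v v.2) (by rwa [← Finset.sum_coe_sort] at h0)
    (by simpa using hspan)
  simpa using key

end Cone

section Circuit

lemma exists_pos_sub_mul_nonneg {ι : Type*} {s : Finset ι} {c b : ι → ℝ} (hc : ∀ i ∈ s, 0 < c i)
    (hb : ∃ i ∈ s, 0 < b i) :
    ∃ t, 0 < t ∧ (∀ i ∈ s, 0 ≤ c i - t * b i) ∧ ∃ i ∈ s, c i - t * b i = 0 := by
  classical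
  obtain ⟨j, hj, hbj⟩ := hb
  obtain ⟨i, hi, hmin⟩ := (s.filter (0 < b ·)).exists_min_image (fun i => c i / b i)
    ⟨j, by simp [hj, hbj]⟩
  rw [Finset.mem_filter] at hi
  have ht : 0 < c i / b i := div_pos (hc i hi.1) hi.2
  refine ⟨c i / b i, ht, fun k hk => ?_, i, hi.1, ?_⟩
  · rcases le_or_gt (b k) 0 with h | h
    · have := hc k hk
      nlinarith
    · have := hmin k (by simp [hk, h])
      rw [le_div_iff₀ h] at this
      linarith
  · rw [div_mul_cancel₀ _ hi.2.ne', sub_self]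

variable {ι E : Type*} [AddCommGroup E] [Module ℝ E]

/-- The family `f` restricted to `s` has no nonzero nonnegative linear relation that omits an
element of `s`. -/
def MinimalRelation (s : Finset ι) (f : ι → E) : Prop :=
  ∀ b : ι → ℝ, (∀ i ∈ s, 0 ≤ b i) → ∑ i ∈ s, b i • f i = 0 → (∃ i ∈ s, b i = 0) →
    ∀ i ∈ s, b i = 0

lemma MinimalRelation.exists_eq_mul {s : Finset ι} {f : ι → E} (hmin : MinimalRelation s f)
    {c : ι → ℝ} (hc : ∀ i ∈ s, 0 < c i) (h0 : ∑ i ∈ s, c i • f i = 0)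
    {b : ι → ℝ} (hb : ∑ i ∈ s, b i • f i = 0) : ∃ t, ∀ i ∈ s, b i = t * c i := by
  have key : ∀ b : ι → ℝ, ∑ i ∈ s, b i • f i = 0 → (∃ i ∈ s, 0 < b i) →
      ∃ t, ∀ i ∈ s, b i = t * c i := by
    intro b hb hpos
    obtain ⟨t, ht, hnn, hz⟩ := exists_pos_sub_mul_nonneg hc hpos
    have := hmin (fun i => c i - t * b i) hnn
      (by simp [sub_smul, mul_smul, ← Finset.smul_sum, h0, hb]) hz
    refine ⟨t⁻¹, fun i hi => ?_⟩
    rw [sub_eq_zero.1 (this i hi), inv_mul_cancel_left₀ ht.ne']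
  by_cases h1 : ∃ i ∈ s, 0 < b i
  · exact key b hb h1
  by_cases h2 : ∃ i ∈ s, b i < 0
  · obtain ⟨t, ht⟩ := key (fun i => - b i) (by simpa using hb) (by simpa using h2)
    exact ⟨-t, fun i hi => by linarith [ht i hi]⟩
  · push Not at h1 h2
    exact ⟨0, fun i hi => by linarith [h1 i hi, h2 i hi]⟩

lemma exists_extend_finset (s : Finset ι) (b : s → ℝ) : ∃ b' : ι → ℝ, ∀ i : s, b' i = b i := by
  classical
  exact ⟨fun i => if h : i ∈ s then b ⟨i, h⟩ else 0, fun i => by simp⟩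

lemma MinimalRelation.finrank_span_add_one {s : Finset ι} {f : ι → E}
    (hmin : MinimalRelation s f) (hne : s.Nonempty) {c : ι → ℝ} (hc : ∀ i ∈ s, 0 < c i)
    (h0 : ∑ i ∈ s, c i • f i = 0) :
    Module.finrank ℝ (Submodule.span ℝ (f '' s)) + 1 = s.card := by
  have hrange : (Fintype.linearCombination ℝ fun i : s => f i).range =
      Submodule.span ℝ (f '' s) := by
    rw [Fintype.range_linearCombination]
    congr 1
    ext x
    simp
  have hker : (Fintype.linearCombination ℝ fun i : s => f i).ker =
      Submodule.span ℝ {fun i : s => c i} := by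
    ext b
    rw [LinearMap.mem_ker, Submodule.mem_span_singleton, Fintype.linearCombination_apply]
    constructor
    · intro hb
      obtain ⟨b', hb'⟩ := exists_extend_finset s b
      simp_rw [← hb'] at hb
      rw [Finset.sum_coe_sort s fun i => b' i • f i] at hb
      obtain ⟨t, ht⟩ := hmin.exists_eq_mul hc h0 hb
      exact ⟨t, funext fun i => by simp [← hb', ht i i.2]⟩
    · rintro ⟨t, rfl⟩
      simp only [Pi.smul_apply, smul_assoc]
      rw [← Finset.smul_sum, Finset.sum_coe_sort s fun i => c i • f i, h0, smul_zero]
  have hc0 : (fun i : s => c i) ≠ 0 := by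
    obtain ⟨i, hi⟩ := hne
    intro h
    exact (hc i hi).ne' (congrFun h ⟨i, hi⟩)
  have := LinearMap.finrank_range_add_finrank_ker (Fintype.linearCombination ℝ fun i : s => f i)
  rw [hrange, hker, finrank_span_singleton hc0] at this
  simpa using this

lemma MinimalRelation.affineIndependent {s : Finset E} (hmin : MinimalRelation s id)
    (hs : PosDep s) : AffineIndependent ℝ ((↑) : s → E) := by
  classical
  obtain ⟨c, hc, h0⟩ := hs
  rw [affineIndependent_iff]
  intro u w hw hwu i hi
  obtain ⟨b, hb⟩ := exists_extend_finset s fun j => if j ∈ u then w j else 0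
  have hu : s.attach ∩ u = u := Finset.inter_eq_right.2 fun x _ => Finset.mem_attach s x
  have h1 : ∑ v ∈ s, b v = 0 := by
    rw [← Finset.sum_coe_sort]
    simp [hb, hw, hu]
  have h2 : ∑ v ∈ s, b v • id v = 0 := by
    rw [← Finset.sum_coe_sort]
    simp [hb, hwu, hu]
  obtain ⟨t, ht⟩ := hmin.exists_eq_mul hc h0 h2
  rw [Finset.sum_congr rfl ht, ← Finset.mul_sum] at h1
  have hpos : 0 < ∑ v ∈ s, c v := Finset.sum_pos hc ⟨i, i.2⟩
  have ht0 : t = 0 := (mul_eq_zero.1 h1).resolve_right hpos.ne'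
  have := hb i
  rw [ht i i.2, ht0, zero_mul, if_pos hi] at this
  exact this.symm

lemma posDep_filter_pos {s : Finset E} {b : E → ℝ} (hb : ∀ v ∈ s, 0 ≤ b v)
    (h0 : ∑ v ∈ s, b v • v = 0) : PosDep (s.filter (0 < b ·)) := by
  refine ⟨b, fun v hv => (Finset.mem_filter.1 hv).2, ?_⟩
  rw [Finset.sum_filter_of_ne, h0]
  intro v hv hne
  refine (hb v hv).lt_of_ne fun h => hne ?_
  rw [← h, zero_smul]

lemma PosDep.exists_pos_sum_eq {s : Finset E} (hs : PosDep s) {x : E}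
    (hx : x ∈ Submodule.span ℝ (s : Set E)) :
    ∃ b : E → ℝ, (∀ v ∈ s, 0 < b v) ∧ ∑ v ∈ s, b v • v = x := by
  obtain ⟨c, hc, h0⟩ := hs
  obtain ⟨a, -, ha⟩ := Submodule.mem_span_finset.1 hx
  have : ∀ᶠ t : ℝ in Filter.atTop, ∀ v ∈ s, 0 < a v + t * c v := by
    rw [Filter.eventually_all_finset]
    exact fun v hv => (Filter.tendsto_atTop_add_const_left _ _
      (Filter.tendsto_id.atTop_mul_const (hc v hv))).eventually_gt_atTop 0
  obtain ⟨t, ht⟩ := this.exists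
  refine ⟨fun v => a v + t * c v, ht, ?_⟩
  simp_rw [add_smul, mul_smul]
  rw [Finset.sum_add_distrib, ← Finset.smul_sum, h0, ha, smul_zero, add_zero]

lemma PosDep.disjUnion {P C : Finset E} (hP : PosDep P) (hd : Disjoint P C) {b : E → ℝ}
    (hb : ∀ v ∈ C, 0 < b v) (hmem : ∑ v ∈ C, b v • v ∈ Submodule.span ℝ (P : Set E)) :
    PosDep (P.disjUnion C hd) := by
  classical
  obtain ⟨d, hd0, hdsum⟩ := hP.exists_pos_sum_eq (neg_mem hmem)
  refine ⟨fun v => if v ∈ P then d v else b v, fun v hv => ?_, ?_⟩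
  · rcases Finset.mem_disjUnion.1 hv with h | h
    · simpa [h] using hd0 v h
    · simpa [Finset.disjoint_right.1 hd h] using hb v h
  · rw [Finset.sum_disjUnion,
      Finset.sum_congr (g := fun v => d v • v) rfl fun v hv => by simp [hv],
      Finset.sum_congr (s₁ := C) (g := fun v => b v • v) rfl fun v hv => by
        simp [Finset.disjoint_right.1 hd hv], hdsum, neg_add_cancel]

/-- No element of `s` is a nonnegative combination of other elements of `s`. -/
def ConeIndep (s : Finset E) : Prop :=
  ∀ v ∈ s, ∀ t ⊆ s, v ∉ t → ∀ b : E → ℝ, (∀ w ∈ t, 0 ≤ b w) → ∑ w ∈ t, b w • w ≠ v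

lemma ConeIndep.notMem_span {s P : Finset E} (h : ConeIndep s) (hPs : P ⊆ s) (hP : PosDep P)
    {v : E} (hv : v ∈ s) (hvP : v ∉ P) : v ∉ Submodule.span ℝ (P : Set E) := by
  intro hmem
  obtain ⟨b, hb, hsum⟩ := hP.exists_pos_sum_eq hmem
  exact h v hv P hPs hvP b (fun w hw => (hb w hw).le) hsum

lemma ConeIndep.finrank_span_lt [FiniteDimensional ℝ E] {s P Q : Finset E} (h : ConeIndep s) (hQs : Q ⊆ s)
    (hP : PosDep P) (hPQ : P ⊂ Q) :
    Module.finrank ℝ (Submodule.span ℝ (P : Set E)) <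
      Module.finrank ℝ (Submodule.span ℝ (Q : Set E)) := by
  obtain ⟨v, hvQ, hvP⟩ := Finset.exists_of_ssubset hPQ
  apply Submodule.finrank_lt_finrank_of_lt
  refine lt_of_le_of_ne (Submodule.span_mono (by exact_mod_cast hPQ.subset)) fun heq => ?_
  apply h.notMem_span (hPQ.subset.trans hQs) hP (hQs hvQ) hvP
  rw [heq]
  exact Submodule.subset_span hvQ

/-- A proper positively dependent subset of maximal rank yields a minimal relation in the
quotient by its span. -/
lemma ConeIndep.minimalRelation_mkQ [FiniteDimensional ℝ E] [DecidableEq E] {s P : Finset E} (h : ConeIndep s)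
    (hPs : P ⊆ s) (hP : PosDep P)
    (hmax : ∀ Q, P ⊆ Q → Q ⊂ s → PosDep Q → Module.finrank ℝ (Submodule.span ℝ (Q : Set E)) ≤
      Module.finrank ℝ (Submodule.span ℝ (P : Set E))) :
    MinimalRelation (s \ P) (Submodule.span ℝ (P : Set E)).mkQ := by
  rintro b hb hsum ⟨i, hi, hbi⟩ j hj
  by_contra hbj
  set C := (s \ P).filter (0 < b ·) with hC
  have hCs : C ⊆ s \ P := Finset.filter_subset _ _
  have hd : Disjoint P C := Finset.disjoint_sdiff.mono_right hCs
  have hjC : j ∈ C := Finset.mem_filter.2 ⟨hj, (hb j hj).lt_of_ne' hbj⟩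
  have hmem : ∑ v ∈ C, b v • v ∈ Submodule.span ℝ (P : Set E) := by
    rw [hC, Finset.sum_filter_of_ne]
    · rw [← Submodule.Quotient.mk_eq_zero, ← Submodule.mkQ_apply, map_sum]
      simpa using hsum
    · intro v hv hne
      refine (hb v hv).lt_of_ne fun h => hne ?_
      rw [← h, zero_smul]
  have hQ := hP.disjUnion hd (fun v hv => (Finset.mem_filter.1 hv).2) hmem
  have hPQ : P ⊂ P.disjUnion C hd := by
    refine Finset.ssubset_iff_exists_cons_subset.2 ⟨j, (Finset.mem_sdiff.1 hj).2, ?_⟩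
    intro x hx
    rcases Finset.mem_cons.1 hx with rfl | hx
    · exact Finset.mem_disjUnion.2 (Or.inr hjC)
    · exact Finset.mem_disjUnion.2 (Or.inl hx)
  have hQs : P.disjUnion C hd ⊂ s := by
    refine Finset.ssubset_iff_subset_ne.2 ⟨fun x hx => ?_, fun heq => ?_⟩
    · rcases Finset.mem_disjUnion.1 hx with hx | hx
      · exact hPs hx
      · exact (Finset.mem_sdiff.1 (hCs hx)).1
    · have : i ∈ P.disjUnion C hd := heq ▸ (Finset.mem_sdiff.1 hi).1
      rcases Finset.mem_disjUnion.1 this with hx | hx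
      · exact (Finset.mem_sdiff.1 hi).2 hx
      · exact (Finset.mem_filter.1 hx).2.ne' hbi
  exact (h.finrank_span_lt hQs.subset hP hPQ).not_ge (hmax _ hPQ.subset hQs hQ)

/-- A positively dependent set that is minimal among those not contained in `P` carries a
minimal relation. -/
lemma minimalRelation_of_minimal {S P : Finset E} (hS : PosDep S) (hSP : ¬ S ⊆ P)
    (hmin : ∀ Q, Q ⊂ S → PosDep Q → Q ⊆ P) : MinimalRelation S id := by
  classical
  obtain ⟨c, hc, h0⟩ := hS
  have hfilter : ∀ b : E → ℝ, (∀ v ∈ S, 0 ≤ b v) → ∑ v ∈ S, b v • v = 0 →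
      (∃ v ∈ S, b v = 0) → ∀ v ∈ S, v ∉ P → b v = 0 := by
    rintro b hb hsum ⟨i, hi, hbi⟩ v hv hvP
    have hlt : S.filter (0 < b ·) ⊂ S := Finset.filter_ssubset.2 ⟨i, hi, by simp [hbi]⟩
    by_contra hne
    exact hvP (hmin _ hlt (posDep_filter_pos hb hsum)
      (Finset.mem_filter.2 ⟨hv, (hb v hv).lt_of_ne' hne⟩))
  obtain ⟨d, hdS, hdP⟩ := Finset.not_subset.1 hSP
  intro b hb hsum hz
  have hbd := hfilter b hb hsum hz d hdS hdP
  by_contra! hne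
  obtain ⟨j, hj, hbj⟩ := hne
  obtain ⟨t, -, hnn, hz'⟩ := exists_pos_sub_mul_nonneg hc ⟨j, hj, (hb j hj).lt_of_ne' hbj⟩
  have hsum' : ∑ v ∈ S, b v • v = 0 := hsum
  have := hfilter (fun v => c v - t * b v) hnn
    (by simp [sub_smul, mul_smul, ← Finset.smul_sum, h0, hsum']) hz' d hdS hdP
  rw [hbd, mul_zero, sub_zero] at this
  exact (hc d hdS).ne' this

/-- **Structure of minimal positively spanning sets.** -/
theorem ConeIndep.exists_decomposition [FiniteDimensional ℝ E] [DecidableEq E] {s : Finset E} (h : ConeIndep s)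
    (hs : PosDep s) (hspan : Submodule.span ℝ (s : Set E) = ⊤)
    (hex : ∃ P, P ⊂ s ∧ P.Nonempty ∧ PosDep P) :
    ∃ P S : Finset E, P ⊂ s ∧ P.Nonempty ∧ PosDep P ∧ s \ P ⊆ S ∧ S ⊆ s ∧ PosDep S ∧
      MinimalRelation S id ∧
      (s \ P).card + Module.finrank ℝ (Submodule.span ℝ (P : Set E)) = Module.finrank ℝ E + 1 ∧
      Module.finrank ℝ (Submodule.span ℝ (P : Set E)) < Module.finrank ℝ E ∧
      Module.finrank ℝ (Submodule.span ℝ (S : Set E)) ≤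
        Module.finrank ℝ (Submodule.span ℝ (P : Set E)) := by
  classical
  obtain ⟨P₀, hP₀s, hP₀ne, hP₀⟩ := hex
  obtain ⟨P, hPmem, hPmax⟩ := (s.powerset.filter fun P => P ⊂ s ∧ P.Nonempty ∧ PosDep P)
    |>.exists_max_image (fun P => Module.finrank ℝ (Submodule.span ℝ (P : Set E)))
    ⟨P₀, by simp [hP₀s, hP₀ne, hP₀, hP₀s.subset]⟩
  obtain ⟨-, hPs, hPne, hP⟩ := Finset.mem_filter.1 hPmem
  have hmax : ∀ Q, Q.Nonempty → Q ⊂ s → PosDep Q →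
      Module.finrank ℝ (Submodule.span ℝ (Q : Set E)) ≤
        Module.finrank ℝ (Submodule.span ℝ (P : Set E)) := fun Q hQne hQs hQ =>
    hPmax Q (by simp [hQne, hQs, hQ, hQs.subset])
  have hD := h.minimalRelation_mkQ hPs.subset hP
    fun Q hPQ hQs hQ => hmax Q (hPne.mono hPQ) hQs hQ
  have hDne : (s \ P).Nonempty := Finset.sdiff_nonempty.2 hPs.not_subset
  have hmkQ : ∀ v ∈ P, (Submodule.span ℝ (P : Set E)).mkQ v = 0 := fun v hv => by
    rw [Submodule.mkQ_apply, Submodule.Quotient.mk_eq_zero]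
    exact Submodule.subset_span hv
  have hproj : ∀ (Q : Finset E) (b : E → ℝ), ∑ v ∈ Q, b v • v = 0 →
      ∑ v ∈ Q \ P, b v • (Submodule.span ℝ (P : Set E)).mkQ v = 0 := by
    intro Q b hb
    have := congrArg (Submodule.span ℝ (P : Set E)).mkQ hb
    simp only [map_sum, map_smul, map_zero] at this
    rw [← this]
    refine Finset.sum_subset Finset.sdiff_subset fun v hv hv' => ?_
    rw [hmkQ v (by simpa [hv] using hv'), smul_zero]
  have hcard : (s \ P).card + Module.finrank ℝ (Submodule.span ℝ (P : Set E)) =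
      Module.finrank ℝ E + 1 := by
    obtain ⟨c, hc, h0⟩ := hs
    have h1 := hD.finrank_span_add_one hDne (fun v hv => hc v (Finset.mem_sdiff.1 hv).1)
      (hproj s c h0)
    have htop : Submodule.span ℝ
        ((Submodule.span ℝ (P : Set E)).mkQ '' ((s \ P : Finset E) : Set E)) = ⊤ := by
      rw [eq_top_iff, ← Submodule.range_mkQ (Submodule.span ℝ (P : Set E)),
        LinearMap.range_eq_map, ← hspan, Submodule.map_span, Submodule.span_le]
      rintro _ ⟨v, hv, rfl⟩
      by_cases hvP : v ∈ P
      · rw [hmkQ v hvP]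
        exact zero_mem _
      · exact Submodule.subset_span ⟨v, Finset.mem_coe.2 (Finset.mem_sdiff.2 ⟨hv, hvP⟩), rfl⟩
    rw [htop, finrank_top] at h1
    have := Submodule.finrank_quotient_add_finrank (Submodule.span ℝ (P : Set E))
    omega
  have hlt : Module.finrank ℝ (Submodule.span ℝ (P : Set E)) < Module.finrank ℝ E := by
    have := h.finrank_span_lt subset_rfl hP hPs
    rwa [hspan, finrank_top] at this
  obtain ⟨S, hSmem, hSmin⟩ := (s.powerset.filter fun Q => PosDep Q ∧ ¬ Q ⊆ P)
    |>.exists_min_image Finset.card ⟨s, by simp [hs, hPs.not_subset]⟩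
  obtain ⟨hSs, hS, hSP⟩ := Finset.mem_filter.1 hSmem
  rw [Finset.mem_powerset] at hSs
  have hSrel : MinimalRelation S id := by
    refine minimalRelation_of_minimal hS hSP fun Q hQS hQ => ?_
    by_contra hQP
    exact (Finset.card_lt_card hQS).not_ge
      (hSmin Q (by simp [hQ, hQP, hQS.subset.trans hSs]))
  have hDS : s \ P ⊆ S := by
    obtain ⟨c, hc, h0⟩ := hS
    obtain ⟨d, hdS, hdP⟩ := Finset.not_subset.1 hSP
    by_contra hsub
    obtain ⟨e, heD, heS⟩ := Finset.not_subset.1 hsub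
    have := hD (fun v => if v ∈ S then c v else 0)
      (fun v _ => by
        split_ifs with hv
        exacts [(hc v hv).le, le_rfl])
      (by
        rw [← hproj S c h0]
        refine (Finset.sum_subset (Finset.sdiff_subset_sdiff hSs subset_rfl) ?_).symm.trans
          (Finset.sum_congr rfl fun v hv => by simp [(Finset.mem_sdiff.1 hv).1])
        intro v hv hv'
        have : v ∉ S := fun hvS => hv' (Finset.mem_sdiff.2 ⟨hvS, (Finset.mem_sdiff.1 hv).2⟩)
        simp [this])
      ⟨e, heD, by simp [heS]⟩ d (Finset.mem_sdiff.2 ⟨hSs hdS, hdP⟩)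
    rw [if_pos hdS] at this
    exact (hc d hdS).ne' this
  have hSne : S ≠ s := by
    rintro rfl
    obtain ⟨c, hc, h0⟩ := hP
    obtain ⟨e, he⟩ := hDne
    obtain ⟨p, hp⟩ := hPne
    have := hSrel (fun v => if v ∈ P then c v else 0)
      (fun v _ => by
        split_ifs with hv
        exacts [(hc v hv).le, le_rfl])
      (by
        rw [← h0]
        refine (Finset.sum_subset hPs.subset fun v _ hv => by simp [hv]).symm.trans
          (Finset.sum_congr rfl fun v hv => by simp [hv]))
      ⟨e, hDS he, by simp [(Finset.mem_sdiff.1 he).2]⟩ p (hPs.subset hp)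
    rw [if_pos hp] at this
    exact (hc p hp).ne' this
  exact ⟨P, S, hPs, hPne, hP, hDS, hSs, hS, hSrel, hcard, hlt,
    hmax S (hDne.mono hDS) (Finset.ssubset_iff_subset_ne.2 ⟨hSs, hSne⟩) hS⟩

end Circuit

section Polytope

variable {E : Type*} [NormedAddCommGroup E] [NormedSpace ℝ E]

lemma posDep_of_zero_mem_interior {s : Finset E}
    (h : (0 : E) ∈ interior (convexHull ℝ (s : Set E))) : PosDep s := by
  obtain ⟨b, hb, hsum⟩ :=
    exists_nonneg_sum_eq_of_mem_interior_preimage LinearMap.id h (-∑ v ∈ s, v)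
  refine ⟨fun v => b v + 1, fun v hv => by linarith [hb v hv], ?_⟩
  simp_rw [add_smul, one_smul]
  rw [Finset.sum_add_distrib, hsum, LinearMap.id_apply, neg_add_cancel]

lemma span_eq_top_of_zero_mem_interior {s : Finset E}
    (h : (0 : E) ∈ interior (convexHull ℝ (s : Set E))) :
    Submodule.span ℝ (s : Set E) = ⊤ := by
  refine Submodule.eq_top_iff'.2 fun x => ?_
  obtain ⟨b, -, hsum⟩ := exists_nonneg_sum_eq_of_mem_interior_preimage LinearMap.id h x
  rw [← LinearMap.id_apply (R := ℝ) x, ← hsum]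
  exact Submodule.sum_mem _ fun v hv => Submodule.smul_mem _ _ (Submodule.subset_span hv)

lemma coneIndep_of_minimal [FiniteDimensional ℝ E] {s : Finset E} (hs : PosDep s)
    (hspan : Submodule.span ℝ (s : Set E) = ⊤) (hnt : s.Nontrivial)
    (hmin : ∀ v ∈ s, (0 : E) ∉ interior (convexHull ℝ ((s : Set E) \ {v}))) : ConeIndep s := by
  classical
  intro v hv t hts hvt b hb hsum
  obtain ⟨c, hc, h0⟩ := hs
  have ht : t ⊆ s.erase v := fun w hw => Finset.mem_erase.2 ⟨fun h => hvt (h ▸ hw), hts hw⟩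
  have hsum' : ∑ w ∈ s.erase v, (if w ∈ t then b w else 0) • w = v := by
    rw [← Finset.sum_subset ht fun w _ hw => by rw [if_neg hw, zero_smul]]
    exact (Finset.sum_congr rfl fun w hw => by rw [if_pos hw]).trans hsum
  have hpos : PosDep (s.erase v) := by
    refine ⟨fun w => c w + c v * (if w ∈ t then b w else 0), fun w hw => ?_, ?_⟩
    · refine add_pos_of_pos_of_nonneg (hc w (Finset.mem_of_mem_erase hw))
        (mul_nonneg (hc v hv).le ?_)
      split_ifs with h
      exacts [hb w h, le_rfl]
    · simp_rw [add_smul, mul_smul]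
      rw [Finset.sum_add_distrib, ← Finset.smul_sum, hsum', add_comm,
        Finset.add_sum_erase s (fun w => c w • w) hv, h0]
  have hne : (s.erase v).Nonempty := (Finset.erase_nonempty hv).2 hnt
  have htop : Submodule.span ℝ ((s.erase v : Finset E) : Set E) = ⊤ := by
    rw [eq_top_iff, ← hspan, Submodule.span_le]
    intro w hw
    by_cases hwv : w = v
    · have hmem : ∑ x ∈ t, b x • x ∈ Submodule.span ℝ ((s.erase v : Finset E) : Set E) :=
        Submodule.sum_mem _ fun x hx => Submodule.smul_mem _ _ (Submodule.subset_span (ht hx))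
      rw [hsum] at hmem
      rwa [hwv]
    · exact Submodule.subset_span (Finset.mem_coe.2 (Finset.mem_erase.2 ⟨hwv, hw⟩))
  have := hpos.zero_mem_interior hne htop
  rw [Finset.coe_erase] at this
  exact hmin v hv this

lemma ConeIndep.zero_notMem_interior_preimage {s P : Finset E} (h : ConeIndep s) (hPs : P ⊆ s)
    {v : E} (hv : v ∈ P) :
    (0 : Submodule.span ℝ (P : Set E)) ∉ interior
      {x : Submodule.span ℝ (P : Set E) | (x : E) ∈ convexHull ℝ ((P : Set E) \ {v})} := by
  classical
  intro hint
  rw [← Finset.coe_erase] at hint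
  obtain ⟨b, hb, hsum⟩ := exists_nonneg_sum_eq_of_mem_interior_preimage
    (Submodule.span ℝ (P : Set E)).subtype hint ⟨v, Submodule.subset_span hv⟩
  exact h v (hPs hv) (P.erase v) ((Finset.erase_subset v P).trans hPs) (Finset.notMem_erase v P)
    b hb hsum

lemma minimalRelation_of_forall_not_posDep {s : Finset E}
    (h : ∀ P, P ⊂ s → P.Nonempty → ¬ PosDep P) : MinimalRelation s id := by
  rintro b hb hsum ⟨i, hi, hbi⟩ j hj
  by_contra hne
  exact h _ (Finset.filter_ssubset.2 ⟨i, hi, by simp [hbi]⟩)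
    ⟨j, Finset.mem_filter.2 ⟨hj, (hb j hj).lt_of_ne' hne⟩⟩ (posDep_filter_pos hb hsum)

end Polytope

/-- Lemma 1: a minimal polytope `∇ ⊆ ℝ^n` with vertex set `𝒱` of cardinality `k` is
either an IP simplex (so `k = n+1`), or contains a lower-dimensional minimal polytope
`∇' = conv 𝒱'` and an IP simplex `S = conv (R ∪ (𝒱 \ 𝒱'))` with
`k - k' = n - n' + 1 ≥ 2` and `dim S ≤ n'`. -/
theorem stmt_2 (n k : ℕ) (𝒱 : Set (Fin n → ℝ)) (h𝒱 : 𝒱.Finite)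
    (hk : 𝒱.ncard = k)
    (hvert : 𝒱 = Set.extremePoints ℝ (convexHull ℝ 𝒱))
    (hIP : (0 : Fin n → ℝ) ∈ interior (convexHull ℝ 𝒱))
    (hmin : ∀ V ∈ 𝒱, (0 : Fin n → ℝ) ∉ interior (convexHull ℝ (𝒱 \ {V}))) :
    (AffineIndependent ℝ ((↑) : 𝒱 → (Fin n → ℝ)) ∧ k = n + 1) ∨
    ∃ 𝒱' R : Set (Fin n → ℝ), 𝒱' ⊂ 𝒱 ∧ R ⊆ 𝒱' ∧
      (let U' : Submodule ℝ (Fin n → ℝ) := Submodule.span ℝ 𝒱'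
       let n' : ℕ := Module.finrank ℝ U'
       -- (1) ∇' = conv 𝒱' is a minimal polytope of dimension n' < n
       n' < n ∧
       (⟨0, Submodule.zero_mem U'⟩ : U') ∈
         interior {x : U' | (x : Fin n → ℝ) ∈ convexHull ℝ 𝒱'} ∧
       (∀ V ∈ 𝒱', (⟨0, Submodule.zero_mem U'⟩ : U') ∉
         interior {x : U' | (x : Fin n → ℝ) ∈ convexHull ℝ (𝒱' \ {V})}) ∧
       -- (2) k − k′ = n − n′ + 1 ≥ 2
       k - 𝒱'.ncard = n - n' + 1 ∧ 2 ≤ k - 𝒱'.ncard ∧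
       -- (3) S = conv (R ∪ (𝒱 \ 𝒱')) is an IP simplex
       AffineIndependent ℝ ((↑) : (R ∪ (𝒱 \ 𝒱') : Set (Fin n → ℝ)) → (Fin n → ℝ)) ∧
       (0 : Fin n → ℝ) ∈ intrinsicInterior ℝ (convexHull ℝ (R ∪ (𝒱 \ 𝒱'))) ∧
       -- (4) dim S ≤ n′
       Module.finrank ℝ (Submodule.span ℝ (R ∪ (𝒱 \ 𝒱'))) ≤ n') := by
  classical
  lift 𝒱 to Finset (Fin n → ℝ) using h𝒱
  rw [Set.ncard_coe_finset] at hk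
  have hs := posDep_of_zero_mem_interior hIP
  have hspan := span_eq_top_of_zero_mem_interior hIP
  have hne : 𝒱.Nonempty := by
    simpa using convexHull_nonempty_iff.1 ⟨0, interior_subset hIP⟩
  by_cases hex : ∃ P, P ⊂ 𝒱 ∧ P.Nonempty ∧ PosDep P
  · right
    have hnt : 𝒱.Nontrivial := by
      obtain ⟨P, hP, ⟨p, hp⟩, -⟩ := hex
      obtain ⟨v, hv, hvP⟩ := Finset.exists_of_ssubset hP
      exact ⟨v, hv, p, hP.subset hp, fun h => hvP (h ▸ hp)⟩
    have hcone := coneIndep_of_minimal hs hspan hnt hmin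
    obtain ⟨P, S, hPs, hPne, hP, hDS, hSs, hS, hSrel, hcard, hlt, hle⟩ :=
      hcone.exists_decomposition hs hspan hex
    rw [Module.finrank_fin_fun] at hcard hlt
    have hRD : ((S ∩ P : Finset (Fin n → ℝ)) ∪ ((𝒱 : Set (Fin n → ℝ)) \ P) :
        Set (Fin n → ℝ)) = S := by
      rw [← Finset.coe_sdiff, ← Finset.coe_union, Finset.coe_inj]
      ext x
      have := @hDS x
      have := @hSs x
      simp only [Finset.mem_union, Finset.mem_inter, Finset.mem_sdiff] at *
      tauto
    have hSne : S.Nonempty := (Finset.sdiff_nonempty.2 hPs.not_subset).mono hDS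
    rw [Finset.card_sdiff_of_subset hPs.subset] at hcard
    refine ⟨P, (S ∩ P : Finset (Fin n → ℝ)), by exact_mod_cast hPs,
      by exact_mod_cast Finset.inter_subset_right, ?_⟩
    rw [hRD, Set.ncard_coe_finset]
    refine ⟨hlt, hP.zero_mem_interior_preimage hPne,
      fun v hv => hcone.zero_notMem_interior_preimage hPs.subset hv, by omega, by omega,
      hSrel.affineIndependent hS, hS.zero_mem_intrinsicInterior hSne, hle⟩
  · left
    push Not at hex
    have hrel := minimalRelation_of_forall_not_posDep hex
    refine ⟨hrel.affineIndependent hs, ?_⟩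
    obtain ⟨c, hc, h0⟩ := hs
    have := hrel.finrank_span_add_one hne hc h0
    rw [Set.image_id, hspan, finrank_top, Module.finrank_fin_fun] at this
    omega
end

section
/- Every minimal polytope ∇ ⊆ ℝ² is of one of the following two forms: (i) a triangle conv{V₁, V₂, V₃} containing the origin 0 in its interior; or (ii) a quadrilateral conv{V₁, V₂, V₁′, V₂′} with four distinct vertices V₁, V₂, V₁′, V₂′ such that 0 lies in the open segment between V₁ and V₂ and also in the open segment between V₁′ and V₂′. -/
open Set

/-- If `0` is a combination with positive coefficients of vectors of `S` that span the whole
space, then `0` is an interior point of the convex hull of `S`. -/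
theorem zero_mem_interior_convexHull_of_sum_smul_eq_zero {E ι : Type*} [NormedAddCommGroup E]
    [NormedSpace ℝ E] [FiniteDimensional ℝ E] [Fintype ι] {S : Set E} {p : ι → E}
    (hp : ∀ i, p i ∈ S) {w : ι → ℝ} (hw : ∀ i, 0 < w i) (h0 : ∑ i, w i • p i = 0)
    (hspan : Submodule.span ℝ (range p) = ⊤) (hS : (0 : E) ∈ convexHull ℝ S) :
    (0 : E) ∈ interior (convexHull ℝ S) := by
  set L : (ι → ℝ) →ₗ[ℝ] E := Fintype.linearCombination ℝ p with hL
  have hsurj : Function.Surjective L := by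
    rw [← LinearMap.range_eq_top, hL, Fintype.range_linearCombination, hspan]
  have hopen : IsOpenMap L := L.isOpenMap_of_finiteDimensional hsurj
  set U : Set (ι → ℝ) := {v | (∀ i, 0 < v i) ∧ ∑ i, v i < 1} with hU
  have hUo : IsOpen U := by
    rw [hU, ofPred_and]
    refine IsOpen.inter ?_ (isOpen_lt (by fun_prop) continuous_const)
    simp only [ofPred_forall]
    exact isOpen_iInter_of_finite fun i => isOpen_lt continuous_const (continuous_apply i)
  have hσ : 0 ≤ ∑ i, w i := Finset.sum_nonneg fun i _ => (hw i).le
  have h0U : (0 : E) ∈ L '' U := by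
    refine ⟨(1 + ∑ i, w i)⁻¹ • w, ⟨fun i => ?_, ?_⟩, ?_⟩
    · have := hw i
      simp only [Pi.smul_apply, smul_eq_mul]
      positivity
    · simp only [Pi.smul_apply, smul_eq_mul, ← Finset.mul_sum]
      rw [inv_mul_lt_iff₀ (by positivity)]
      linarith
    · rw [map_smul, hL, Fintype.linearCombination_apply, h0, smul_zero]
  refine mem_interior.2 ⟨L '' U, ?_, hopen _ hUo, h0U⟩
  rintro _ ⟨v, ⟨hv, hv1⟩, rfl⟩
  have := (convex_convexHull ℝ S).sum_mem (t := (Finset.univ : Finset (Option ι)))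
    (w := fun o => o.elim (1 - ∑ i, v i) v) (z := fun o => o.elim 0 p)
    (by rintro (_ | i) - <;> simp [hv1.le, (hv _).le]) (by simp [Fintype.sum_option])
    (by rintro (_ | i) -
        · exact hS
        · exact subset_convexHull ℝ S (hp i))
  simpa [Fintype.sum_option, hL, Fintype.linearCombination_apply] using this

/-- A linear functional that is somewhere positive is positive at a point of `S` when `0` is an
interior point of the convex hull of `S`. -/
theorem exists_pos_of_zero_mem_interior_convexHull {E : Type*} [NormedAddCommGroup E]
    [NormedSpace ℝ E] {S : Set E} (hS : (0 : E) ∈ interior (convexHull ℝ S)) (f : E →ₗ[ℝ] ℝ)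
    {x : E} (hx : 0 < f x) : ∃ s ∈ S, 0 < f s := by
  by_contra! h
  have hsub : convexHull ℝ S ⊆ {y | f y ≤ 0} :=
    convexHull_min h (convex_halfSpace_le f.isLinear 0)
  have hlim : Filter.Tendsto (fun t : ℝ => t • x) (nhdsWithin 0 (Ioi 0)) (nhds 0) := by
    have : Continuous fun t : ℝ => t • x := by fun_prop
    simpa using (this.tendsto 0).mono_left nhdsWithin_le_nhds
  obtain ⟨t, ht, ht0⟩ :=
    ((hlim.eventually (mem_interior_iff_mem_nhds.1 hS)).and self_mem_nhdsWithin).exists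
  have := hsub ht
  simp only [mem_ofPred_eq, map_smul, smul_eq_mul] at this
  exact absurd this (not_le.2 (mul_pos ht0 hx))

/-- In a nontrivial space, `0` is not an extreme point of a set having it as an interior point. -/
theorem zero_notMem_extremePoints_of_mem_interior {E : Type*} [NormedAddCommGroup E]
    [NormedSpace ℝ E] [Nontrivial E] {C : Set E} (hC : (0 : E) ∈ interior C) :
    (0 : E) ∉ extremePoints ℝ C := by
  intro h
  obtain ⟨x, hx⟩ := exists_ne (0 : E)
  have hlim (y : E) : Filter.Tendsto (fun t : ℝ => t • y) (nhdsWithin 0 (Ioi 0)) (nhds 0) := by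
    have : Continuous fun t : ℝ => t • y := by fun_prop
    simpa using (this.tendsto 0).mono_left nhdsWithin_le_nhds
  have hC' := mem_interior_iff_mem_nhds.1 hC
  obtain ⟨t, ⟨ht, ht'⟩, ht0⟩ := ((((hlim x).eventually hC').and
    ((hlim (-x)).eventually hC')).and self_mem_nhdsWithin).exists
  have := h.2 ht ht' ⟨1 / 2, 1 / 2, by norm_num, by norm_num, by norm_num, by simp⟩
  exact (smul_ne_zero (ne_of_gt ht0) hx) this

/-- The determinant of two plane vectors, as a linear form in the second one. -/
def planeDet (v : Fin 2 → ℝ) : (Fin 2 → ℝ) →ₗ[ℝ] ℝ :=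
  v 0 • LinearMap.proj 1 - v 1 • LinearMap.proj 0

theorem planeDet_apply (v x : Fin 2 → ℝ) : planeDet v x = v 0 * x 1 - v 1 * x 0 := by
  simp [planeDet]

theorem sq_add_sq_pos_of_ne_zero {v : Fin 2 → ℝ} (hv : v ≠ 0) : 0 < v 0 ^ 2 + v 1 ^ 2 := by
  by_contra! h
  refine hv (funext fun i => ?_)
  fin_cases i <;> simp <;> nlinarith [sq_nonneg (v 0), sq_nonneg (v 1)]

theorem exists_eq_smul_of_planeDet_eq_zero {v x : Fin 2 → ℝ} (hv : v ≠ 0)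
    (h : planeDet v x = 0) : ∃ t : ℝ, x = t • v := by
  have hpos := sq_add_sq_pos_of_ne_zero hv
  rw [planeDet_apply] at h
  refine ⟨(v 0 * x 0 + v 1 * x 1) / (v 0 ^ 2 + v 1 ^ 2), funext fun i => ?_⟩
  fin_cases i <;> simp <;> field_simp
  · linear_combination (-v 1) * h
  · linear_combination (v 0) * h

theorem span_eq_top_of_planeDet_ne_zero {v x : Fin 2 → ℝ} (h : planeDet v x ≠ 0)
    {s : Set (Fin 2 → ℝ)} (hv : v ∈ s) (hx : x ∈ s) : Submodule.span ℝ s = ⊤ := by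
  refine Submodule.eq_top_iff'.2 fun y => ?_
  have hy : y = (planeDet y x / planeDet v x) • v + (planeDet v y / planeDet v x) • x := by
    funext i
    have h' : (planeDet v x)⁻¹ * (v 0 * x 1 - v 1 * x 0) = 1 := by
      rw [← planeDet_apply]
      exact inv_mul_cancel₀ h
    simp only [div_eq_mul_inv]
    generalize (planeDet v x)⁻¹ = d at h' ⊢
    simp only [planeDet_apply]
    fin_cases i <;> simp
    · linear_combination (-y 0) * h'
    · linear_combination (-y 1) * h'
  rw [hy]
  exact add_mem (Submodule.smul_mem _ _ (Submodule.subset_span hv))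
    (Submodule.smul_mem _ _ (Submodule.subset_span hx))

/-- A triple of plane vectors with a vanishing positive combination, two of which are
independent, has `0` in the interior of its convex hull. -/
theorem zero_mem_interior_convexHull_triple {a b c : ℝ} {A B C : Fin 2 → ℝ} (ha : 0 < a)
    (hb : 0 < b) (hc : 0 < c) (h0 : a • A + b • B + c • C = 0) (hdet : planeDet A B ≠ 0) :
    (0 : Fin 2 → ℝ) ∈ interior (convexHull ℝ {A, B, C}) := by
  refine zero_mem_interior_convexHull_of_sum_smul_eq_zero (p := ![A, B, C]) (w := ![a, b, c])
    (fun i => by fin_cases i <;> simp) (fun i => by fin_cases i <;> simpa)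
    (by simpa [Fin.sum_univ_three] using h0)
    (span_eq_top_of_planeDet_ne_zero hdet ⟨0, rfl⟩ ⟨1, rfl⟩) ?_
  have := (convex_convexHull ℝ {A, B, C}).sum_mem (t := Finset.univ)
    (w := fun i => (a + b + c)⁻¹ * ![a, b, c] i) (z := ![A, B, C])
    (fun i _ => by fin_cases i <;> simp <;> positivity)
    (by rw [← Finset.mul_sum, Fin.sum_univ_three]; simp; field_simp)
    (fun i _ => subset_convexHull ℝ _ (by fin_cases i <;> simp))
  simp only [mul_smul, ← Finset.smul_sum] at this
  simpa [Fin.sum_univ_three, h0] using this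

/-- If a combination of `A` and `B` with positive coefficients vanishes, then `0` lies in the open
segment between them. -/
theorem zero_mem_openSegment_of_smul_add_smul_eq_zero {E : Type*} [AddCommGroup E] [Module ℝ E]
    {a b : ℝ} {A B : E} (ha : 0 < a) (hb : 0 < b) (h0 : a • A + b • B = 0) :
    (0 : E) ∈ openSegment ℝ A B := by
  refine ⟨(a + b)⁻¹ * a, (a + b)⁻¹ * b, by positivity, by positivity, by field_simp, ?_⟩
  rw [mul_smul, mul_smul, ← smul_add, h0, smul_zero]

/-- Every minimal polytope in `ℝ²` is either a triangle with `0` in its interior, or a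
quadrilateral whose vertex set splits into two diagonals through the origin. -/
theorem stmt_4 (𝒱 : Set (Fin 2 → ℝ)) (h𝒱 : 𝒱.Finite)
    (hvert : 𝒱 = Set.extremePoints ℝ (convexHull ℝ 𝒱))
    (hIP : (0 : Fin 2 → ℝ) ∈ interior (convexHull ℝ 𝒱))
    (hmin : ∀ V ∈ 𝒱, (0 : Fin 2 → ℝ) ∉ interior (convexHull ℝ (𝒱 \ {V}))) :
    (∃ V₁ V₂ V₃ : Fin 2 → ℝ, V₁ ≠ V₂ ∧ V₁ ≠ V₃ ∧ V₂ ≠ V₃ ∧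
        𝒱 = {V₁, V₂, V₃} ∧
        (0 : Fin 2 → ℝ) ∈ interior (convexHull ℝ ({V₁, V₂, V₃} : Set (Fin 2 → ℝ)))) ∨
    (∃ V₁ V₂ V₁' V₂' : Fin 2 → ℝ,
        V₁ ≠ V₂ ∧ V₁ ≠ V₁' ∧ V₁ ≠ V₂' ∧ V₂ ≠ V₁' ∧ V₂ ≠ V₂' ∧ V₁' ≠ V₂' ∧
        𝒱 = {V₁, V₂, V₁', V₂'} ∧
        (0 : Fin 2 → ℝ) ∈ openSegment ℝ V₁ V₂ ∧
        (0 : Fin 2 → ℝ) ∈ openSegment ℝ V₁' V₂') := by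
  have hzero : (0 : Fin 2 → ℝ) ∉ 𝒱 := by
    rw [hvert]
    exact zero_notMem_extremePoints_of_mem_interior hIP
  have huniq {T : Set (Fin 2 → ℝ)} (hT : T ⊆ 𝒱) (h : (0 : Fin 2 → ℝ) ∈ interior (convexHull ℝ T)) :
      𝒱 = T := by
    refine Subset.antisymm (fun V hV => ?_) hT
    by_contra hVT
    exact hmin V hV (interior_mono (convexHull_mono (subset_sdiff_singleton hT hVT)) h)
  obtain ⟨ι, _, z, w, hz, hind, hw, hw1, hw0⟩ :=
    eq_pos_convex_span_of_mem_convexHull (interior_subset hIP)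
  have hcard : Fintype.card ι ≤ 3 := by
    simpa using hind.card_le_finrank_succ.trans (Nat.succ_le_succ (Submodule.finrank_le _))
  have hzmem (i : ι) : z i ∈ 𝒱 := hz ⟨i, rfl⟩
  have e := Fintype.equivFin ι
  have hspan3 (hc : Fintype.card ι = 3) : Submodule.span ℝ (range z) = ⊤ := by
    have htop : affineSpan ℝ (range z) = ⊤ :=
      hind.affineSpan_eq_top_iff_card_eq_finrank_add_one.2 (by simpa using hc)
    refine Submodule.eq_top_iff'.2 fun y => affineSpan_subset_span (k := ℝ) ?_
    rw [htop]
    trivial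
  generalize hn : Fintype.card ι = n at e hcard hspan3
  have hsum : ∑ j, w (e.symm j) • z (e.symm j) = 0 := by
    rw [← hw0]
    exact e.symm.sum_comp fun i => w i • z i
  have hsum1 : ∑ j, w (e.symm j) = 1 := by
    rw [← hw1]
    exact e.symm.sum_comp w
  have hinj : Function.Injective fun j => z (e.symm j) := hind.injective.comp e.symm.injective
  interval_cases n
  · simp at hsum1
  · simp only [Fin.sum_univ_one] at hsum hsum1
    rw [hsum1, one_smul] at hsum
    exact absurd (hsum ▸ hzmem _) hzero
  · right
    rw [Fin.sum_univ_two] at hsum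
    have hA := hzmem (e.symm 0)
    have hB := hzmem (e.symm 1)
    have ha := hw (e.symm 0)
    have hb := hw (e.symm 1)
    have hAB : z (e.symm 0) ≠ z (e.symm 1) := hinj.ne (by decide)
    generalize z (e.symm 0) = A at *
    generalize z (e.symm 1) = B at *
    generalize w (e.symm 0) = a at *
    generalize w (e.symm 1) = b at *
    have hA0 : A ≠ 0 := fun h => hzero (h ▸ hA)
    have hBA : planeDet A B = 0 := by
      have h0 := congrFun hsum 0
      have h1 := congrFun hsum 1
      simp only [Pi.add_apply, Pi.smul_apply, smul_eq_mul, Pi.zero_apply] at h0 h1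
      rw [planeDet_apply]
      refine (mul_eq_zero.1 (?_ : b * _ = 0)).resolve_left hb.ne'
      linear_combination A 0 * h1 - A 1 * h0
    have hAA : planeDet A A = 0 := by rw [planeDet_apply]; ring
    have hpos := sq_add_sq_pos_of_ne_zero hA0
    obtain ⟨P, hP, hfP⟩ := exists_pos_of_zero_mem_interior_convexHull hIP (planeDet A)
      (x := ![-A 1, A 0]) (by rw [planeDet_apply]; simp; nlinarith)
    obtain ⟨Q, hQ, hfQ⟩ := exists_pos_of_zero_mem_interior_convexHull hIP (-planeDet A)
      (x := ![A 1, -A 0]) (by rw [LinearMap.neg_apply, planeDet_apply]; simp; nlinarith)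
    rw [LinearMap.neg_apply] at hfQ
    have hAP : A ≠ P := by rintro rfl; linarith
    have hAQ : A ≠ Q := by rintro rfl; linarith
    have hBP : B ≠ P := by rintro rfl; linarith
    have hBQ : B ≠ Q := by rintro rfl; linarith
    have hPQ : P ≠ Q := by rintro rfl; linarith
    obtain ⟨t, ht⟩ := exists_eq_smul_of_planeDet_eq_zero hA0
      (x := (-planeDet A Q) • P + planeDet A P • Q) (by simp; ring)
    rcases lt_trichotomy t 0 with htneg | rfl | htpos
    · have hint := zero_mem_interior_convexHull_triple (neg_pos.2 htneg) hfQ hfP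
        (by rw [add_assoc, ht, neg_smul, neg_add_cancel]) hfP.ne'
      have hB' := huniq (by simp [insert_subset_iff, hA, hP, hQ]) hint ▸ hB
      simp [hAB.symm, hBP, hBQ] at hB'
    · rw [zero_smul] at ht
      have hsub : ({A, B, P, Q} : Set (Fin 2 → ℝ)) ⊆ 𝒱 := by
        simp [insert_subset_iff, hA, hB, hP, hQ]
      have hseg := zero_mem_openSegment_of_smul_add_smul_eq_zero ha hb hsum
      refine ⟨A, B, P, Q, hAB, hAP, hAQ, hBP, hBQ, hPQ, huniq hsub ?_, hseg,
        zero_mem_openSegment_of_smul_add_smul_eq_zero hfQ hfP ht⟩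
      refine zero_mem_interior_convexHull_of_sum_smul_eq_zero (p := ![A, B, P, Q])
        (w := ![a, b, -planeDet A Q, planeDet A P])
        (fun i => by fin_cases i <;> simp) (fun i => by fin_cases i <;> assumption)
        (by
          rw [Fin.sum_univ_four, add_assoc]
          exact (congrArg₂ (· + ·) hsum ht).trans (add_zero 0))
        (span_eq_top_of_planeDet_ne_zero hfP.ne' ⟨0, rfl⟩ ⟨2, rfl⟩)
        (convexHull_mono (by simp [insert_subset_iff]) (segment_subset_convexHull (s := {A, B})
          (by simp) (by simp) (openSegment_subset_segment _ _ _ hseg)))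
    · have hint := zero_mem_interior_convexHull_triple (A := P) (B := B) (C := Q)
        (mul_pos ha hfQ) (mul_pos htpos hb) (mul_pos ha hfP) (by
          simp only [mul_smul]
          rw [add_right_comm, ← smul_add, ht, smul_comm, ← smul_add, hsum, smul_zero]) (by
          intro h
          have h0 := congrFun hsum 0
          have h1 := congrFun hsum 1
          simp only [Pi.add_apply, Pi.smul_apply, smul_eq_mul, Pi.zero_apply] at h0 h1
          rw [planeDet_apply] at h hfP
          refine (mul_pos ha hfP).ne' ?_
          linear_combination P 1 * h0 - P 0 * h1 + b * h)
      have hA' := huniq (by simp [insert_subset_iff, hB, hP, hQ]) hint ▸ hA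
      simp [hAB, hAP, hAQ] at hA'
  · left
    rw [Fin.sum_univ_three] at hsum
    have hrange : range z = {z (e.symm 0), z (e.symm 1), z (e.symm 2)} := by
      ext y
      simp [← e.symm.exists_congr_right, Fin.exists_fin_succ, eq_comm]
    have hint := zero_mem_interior_convexHull_of_sum_smul_eq_zero (fun i => mem_range_self i)
      hw hw0 (hspan3 rfl) (hw0 ▸ (convex_convexHull ℝ (range z)).sum_mem (fun i _ => (hw i).le) hw1
        fun i _ => subset_convexHull ℝ _ (mem_range_self i))
    rw [hrange] at hint
    exact ⟨_, _, _, hinj.ne (by decide), hinj.ne (by decide), hinj.ne (by decide),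
      huniq (hrange ▸ hz) hint, hint⟩
end

section
/- Let P ⊆ ℝ² be a lattice polygon (a two-dimensional polytope all of whose vertices lie in ℤ²) such that the only lattice point of ℤ² lying in the interior of P is the origin 0. Then P is reflexive, i.e. its dual P* = {y ∈ ℝ² : ⟨y, x⟩ ≥ −1 for all x ∈ P} is again a lattice polygon. -/
/-- A point of `ℝ^k` is a lattice point if all its coordinates are integers. -/
def IsLatticePt {k : ℕ} (x : Fin k → ℝ) : Prop := ∀ i, ∃ m : ℤ, x i = (m : ℝ)

/-- The set of `y` with `-1 ≤ ⟨y, x⟩` for all `x` in `P`. -/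
def dualSet (P : Set (Fin 2 → ℝ)) : Set (Fin 2 → ℝ) := {y | ∀ x ∈ P, -1 ≤ ∑ i, y i * x i}

lemma dualSet_convexHull (F : Set (Fin 2 → ℝ)) : dualSet (convexHull ℝ F) = dualSet F := by
  ext y
  refine ⟨fun h x hx => h x (subset_convexHull ℝ F hx), fun h => ?_⟩
  have hc : Convex ℝ {x : Fin 2 → ℝ | -1 ≤ ∑ i, y i * x i} := by
    intro u hu v hv s t hs ht hst
    simp only [Set.mem_ofPred_eq, Fin.sum_univ_two, Pi.add_apply, Pi.smul_apply,
      smul_eq_mul] at hu hv ⊢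
    nlinarith [mul_le_mul_of_nonneg_left hu hs, mul_le_mul_of_nonneg_left hv ht]
  exact convexHull_min h hc

lemma convex_dualSet (P : Set (Fin 2 → ℝ)) : Convex ℝ (dualSet P) := by
  intro u hu v hv s t hs ht hst x hx
  have hu := hu x hx
  have hv := hv x hx
  simp only [Fin.sum_univ_two, Pi.add_apply, Pi.smul_apply, smul_eq_mul] at hu hv ⊢
  nlinarith [mul_le_mul_of_nonneg_left hu hs, mul_le_mul_of_nonneg_left hv ht]

lemma isClosed_dualSet (P : Set (Fin 2 → ℝ)) : IsClosed (dualSet P) := by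
  simp only [dualSet, Set.ofPred_forall]
  refine isClosed_biInter fun x _ => isClosed_le continuous_const ?_
  fun_prop

lemma exists_dualSet_subset_Icc {P : Set (Fin 2 → ℝ)} (h0 : (0 : Fin 2 → ℝ) ∈ interior P) :
    ∃ N : ℕ, dualSet P ⊆ Set.Icc (fun _ => -(N : ℝ)) (fun _ => (N : ℝ)) := by
  obtain ⟨r, hr, hball⟩ := Metric.isOpen_iff.1 isOpen_interior 0 h0
  obtain ⟨N, hN⟩ := exists_nat_gt (2 / r)
  have hN' : 1 < N * (r / 2) := by
    rw [div_lt_iff₀ hr] at hN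
    linarith
  refine ⟨N, fun y hy => ?_⟩
  have key : ∀ i, ∀ c : ℝ, |c| < r → -1 ≤ y i * c := by
    intro i c hc
    have hmem : Pi.single i c ∈ P := by
      refine interior_subset (hball ?_)
      rw [mem_ball_zero_iff, Pi.norm_single]
      exact hc
    simpa [Pi.single_apply] using hy _ hmem
  have h1 : ∀ i, -1 ≤ y i * (r / 2) := fun i =>
    key i _ (by rw [abs_of_pos (by linarith)]; linarith)
  have h2 : ∀ i, -1 ≤ y i * (-(r / 2)) := fun i =>
    key i _ (by rw [abs_neg, abs_of_pos (by linarith)]; linarith)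
  refine ⟨fun i => ?_, fun i => ?_⟩
  · have := h1 i
    show -(N : ℝ) ≤ y i
    by_contra! h
    nlinarith
  · have := h2 i
    show y i ≤ (N : ℝ)
    by_contra! h
    nlinarith

lemma finite_isLatticePt_inter_Icc (N : ℕ) :
    {x : Fin 2 → ℝ | IsLatticePt x ∧
      x ∈ Set.Icc (fun _ => -(N : ℝ)) (fun _ => (N : ℝ))}.Finite := by
  refine ((Set.finite_Icc (fun _ : Fin 2 => -(N : ℤ)) (fun _ => (N : ℤ))).image
    (fun m i => (m i : ℝ))).subset ?_
  rintro x ⟨hx, h1, h2⟩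
  choose m hm using hx
  refine ⟨m, ⟨fun i => ?_, fun i => ?_⟩, funext fun i => (hm i).symm⟩
  · have : -(N : ℝ) ≤ x i := h1 i
    rw [hm i] at this
    show -(N : ℤ) ≤ m i
    exact_mod_cast this
  · have : x i ≤ (N : ℝ) := h2 i
    rw [hm i] at this
    show m i ≤ (N : ℤ)
    exact_mod_cast this

/-- At an extreme point of the dual of a finite set, two linearly independent constraints
are active. -/
lemma exists_active_pair {F : Set (Fin 2 → ℝ)} (hF : F.Finite) {y : Fin 2 → ℝ}
    (hy : y ∈ (dualSet F).extremePoints ℝ) :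
    ∃ a ∈ F, ∃ b ∈ F, ∑ i, y i * a i = -1 ∧ ∑ i, y i * b i = -1 ∧
      a 0 * b 1 - a 1 * b 0 ≠ 0 := by
  by_contra! hcon
  obtain ⟨d, hd0, hd⟩ : ∃ d : Fin 2 → ℝ, d ≠ 0 ∧
      ∀ x ∈ F, ∑ i, y i * x i = -1 → ∑ i, d i * x i = 0 := by
    by_cases hA : ∃ a ∈ F, ∑ i, y i * a i = -1
    · obtain ⟨a, ha, hya⟩ := hA
      refine ⟨![-a 1, a 0], fun h => ?_, fun x hx hyx => ?_⟩
      · have e0 := congrFun h 0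
        have e1 := congrFun h 1
        simp at e0 e1
        simp [Fin.sum_univ_two, e0, e1] at hya
      · have := hcon a ha x hx hya hyx
        simp [Fin.sum_univ_two]
        linarith
    · push Not at hA
      exact ⟨fun _ => 1, fun h => one_ne_zero (congrFun h 0), fun x hx h => absurd h (hA x hx)⟩
  have hev : ∀ e : Fin 2 → ℝ, (∀ x ∈ F, ∑ i, y i * x i = -1 → ∑ i, e i * x i = 0) →
      ∀ᶠ t : ℝ in nhdsWithin 0 (Set.Ioi 0), y + t • e ∈ dualSet F := by
    intro e he
    refine (Filter.eventually_all_finite hF).2 fun x hx => ?_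
    have hsum : ∀ t : ℝ, ∑ i, (y + t • e) i * x i = ∑ i, y i * x i + t * ∑ i, e i * x i := by
      intro t
      simp only [Fin.sum_univ_two, Pi.add_apply, Pi.smul_apply, smul_eq_mul]
      ring
    rcases (hy.1 x hx).eq_or_lt with h | h
    · refine Filter.Eventually.of_forall fun t => ?_
      rw [hsum, he x hx h.symm, mul_zero, add_zero]
      exact h.le
    · refine Filter.Eventually.filter_mono nhdsWithin_le_nhds ?_
      simp only [hsum]
      have hc : Continuous fun t : ℝ => ∑ i, y i * x i + t * ∑ i, e i * x i := by fun_prop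
      exact (hc.tendsto 0).eventually_const_le (by simpa using h)
  have hneg : ∀ x ∈ F, ∑ i, y i * x i = -1 → ∑ i, (-d) i * x i = 0 := by
    intro x hx h
    simp only [Pi.neg_apply, neg_mul, Finset.sum_neg_distrib, hd x hx h, neg_zero]
  obtain ⟨t, ⟨h1, h2⟩, ht⟩ :=
    (((hev d hd).and (hev (-d) hneg)).and self_mem_nhdsWithin).exists
  have hseg : y ∈ openSegment ℝ (y + t • d) (y + t • -d) := by
    refine ⟨1 / 2, 1 / 2, by norm_num, by norm_num, by norm_num, ?_⟩
    ext i
    simp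
    ring
  have h := hy.2 h1 h2 hseg
  rw [add_eq_left, smul_eq_zero] at h
  exact h.elim (ne_of_gt ht) hd0

/-- If the half-open triangle `0, a, b` without the edge `a b` contains no nonzero lattice point,
then the linear form equal to `1` at `a` and `b` is integral on lattice points. -/
lemma exists_int_eq_add_of_triangle {a b : Fin 2 → ℝ} (ha : IsLatticePt a) (hb : IsLatticePt b)
    (h : ∀ s t : ℝ, 0 ≤ s → 0 ≤ t → s + t < 1 → IsLatticePt (s • a + t • b) → s + t = 0)
    {s t : ℝ} (hst : IsLatticePt (s • a + t • b)) : ∃ m : ℤ, s + t = m := by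
  have hs := Int.floor_add_fract s
  have ht := Int.floor_add_fract t
  have hs0 := Int.fract_nonneg s
  have ht0 := Int.fract_nonneg t
  have hs1 := Int.fract_lt_one s
  have ht1 := Int.fract_lt_one t
  have hl : ∀ m n : ℤ, IsLatticePt ((s - m) • a + (t - n) • b) := by
    intro m n i
    obtain ⟨p, hp⟩ := ha i
    obtain ⟨q, hq⟩ := hb i
    obtain ⟨r, hr⟩ := hst i
    refine ⟨r - m * p - n * q, ?_⟩
    simp only [Pi.add_apply, Pi.smul_apply, smul_eq_mul] at hr ⊢
    push_cast
    rw [← hr, ← hp, ← hq]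
    ring
  have hneg : ∀ {x : Fin 2 → ℝ}, IsLatticePt x → IsLatticePt (-x) := by
    intro x hx i
    obtain ⟨p, hp⟩ := hx i
    exact ⟨-p, by simp [hp]⟩
  rcases lt_trichotomy (Int.fract s + Int.fract t) 1 with hlt | heq | hgt
  · have := h _ _ hs0 ht0 hlt (hl ⌊s⌋ ⌊t⌋)
    exact ⟨⌊s⌋ + ⌊t⌋, by push_cast; linarith⟩
  · exact ⟨⌊s⌋ + ⌊t⌋ + 1, by push_cast; linarith⟩
  · have hl' := hneg (hl (⌊s⌋ + 1) (⌊t⌋ + 1))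
    have e : -((s - ((⌊s⌋ + 1 : ℤ) : ℝ)) • a + (t - ((⌊t⌋ + 1 : ℤ) : ℝ)) • b) =
        (1 - Int.fract s) • a + (1 - Int.fract t) • b := by
      ext i
      simp only [Int.fract, Pi.neg_apply, Pi.add_apply, Pi.smul_apply, smul_eq_mul]
      push_cast
      ring
    rw [e] at hl'
    have := h _ _ (by linarith) (by linarith) (by linarith) hl'
    linarith

lemma isLatticePt_of_active_pair {P : Set (Fin 2 → ℝ)} (hP : Convex ℝ P)
    (h0 : (0 : Fin 2 → ℝ) ∈ interior P) (hint : ∀ x ∈ interior P, IsLatticePt x → x = 0)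
    {a b y : Fin 2 → ℝ} (haP : a ∈ P) (hbP : b ∈ P) (ha : IsLatticePt a) (hb : IsLatticePt b)
    (hya : ∑ i, y i * a i = -1) (hyb : ∑ i, y i * b i = -1)
    (hab : a 0 * b 1 - a 1 * b 0 ≠ 0) : IsLatticePt y := by
  have hysum : ∀ s t : ℝ, ∑ i, y i * (s • a + t • b) i = -(s + t) := by
    intro s t
    simp only [Fin.sum_univ_two, Pi.add_apply, Pi.smul_apply, smul_eq_mul] at hya hyb ⊢
    linear_combination s * hya + t * hyb
  have htri : ∀ s t : ℝ, 0 ≤ s → 0 ≤ t → s + t < 1 → IsLatticePt (s • a + t • b) →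
      s + t = 0 := by
    intro s t hs ht hlt hl
    by_cases hz : s + t = 0
    · exact hz
    have hpos : 0 < s + t := lt_of_le_of_ne (by linarith) (Ne.symm hz)
    have hp : (s / (s + t)) • a + (t / (s + t)) • b ∈ P :=
      hP haP hbP (by positivity) (by positivity) (by field_simp)
    have hmem := hP.combo_interior_self_mem_interior h0 hp
      (sub_pos.2 hlt) hpos.le (by ring)
    rw [smul_zero, zero_add, smul_add, smul_smul, smul_smul, mul_div_cancel₀ _ hz,
      mul_div_cancel₀ _ hz] at hmem
    have := hysum s t
    rw [hint _ hmem hl] at this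
    simp at this
    linarith
  have hbasis : ∀ v : Fin 2 → ℝ, ∃ s t : ℝ, s • a + t • b = v := by
    intro v
    have hinv := mul_inv_cancel₀ hab
    refine ⟨(v 0 * b 1 - v 1 * b 0) * (a 0 * b 1 - a 1 * b 0)⁻¹,
      (a 0 * v 1 - a 1 * v 0) * (a 0 * b 1 - a 1 * b 0)⁻¹, ?_⟩
    ext i
    fin_cases i
    · simp only [Fin.zero_eta, Pi.add_apply, Pi.smul_apply, smul_eq_mul]
      linear_combination v 0 * hinv
    · simp only [Fin.mk_one, Pi.add_apply, Pi.smul_apply, smul_eq_mul]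
      linear_combination v 1 * hinv
  intro i
  obtain ⟨s, t, hst⟩ := hbasis (Pi.single i 1)
  have hl : IsLatticePt (s • a + t • b) := by
    rw [hst]
    intro j
    exact ⟨if j = i then 1 else 0, by simp [Pi.single_apply]⟩
  obtain ⟨m, hm⟩ := exists_int_eq_add_of_triangle ha hb htri hl
  refine ⟨-m, ?_⟩
  have := hysum s t
  rw [hst] at this
  push_cast
  rw [← hm, ← this]
  simp [Pi.single_apply]

/-- A lattice polygon in `ℝ²` whose only interior lattice point is the origin is
reflexive: its dual is again a lattice polygon. -/
theorem stmt_7 (F : Set (Fin 2 → ℝ)) (hF : F.Finite) (hFlat : ∀ x ∈ F, IsLatticePt x)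
    (P : Set (Fin 2 → ℝ)) (hP : P = convexHull ℝ F)
    (h0 : (0 : Fin 2 → ℝ) ∈ interior P)
    (hint : ∀ x ∈ interior P, IsLatticePt x → x = 0) :
    ∃ G : Set (Fin 2 → ℝ), G.Finite ∧ (∀ y ∈ G, IsLatticePt y) ∧
      {y : Fin 2 → ℝ | ∀ x ∈ P, -1 ≤ ∑ i, y i * x i} = convexHull ℝ G := by
  obtain ⟨N, hN⟩ := exists_dualSet_subset_Icc h0
  have hlat : ∀ y ∈ (dualSet P).extremePoints ℝ, IsLatticePt y := by
    intro y hy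
    have hy' : y ∈ (dualSet F).extremePoints ℝ := by
      rwa [hP, dualSet_convexHull] at hy
    have hFP : F ⊆ P := hP ▸ subset_convexHull ℝ F
    obtain ⟨a, ha, b, hb, hya, hyb, hab⟩ := exists_active_pair hF hy'
    exact isLatticePt_of_active_pair (hP ▸ convex_convexHull ℝ F) h0 hint (hFP ha) (hFP hb)
      (hFlat a ha) (hFlat b hb) hya hyb hab
  have hfin : ((dualSet P).extremePoints ℝ).Finite :=
    (finite_isLatticePt_inter_Icc N).subset fun y hy => ⟨hlat y hy, hN hy.1⟩
  refine ⟨_, hfin, hlat, ?_⟩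
  have hcomp : IsCompact (dualSet P) := isCompact_Icc.of_isClosed_subset (isClosed_dualSet P) hN
  have hkm := closure_convexHull_extremePoints hcomp (convex_dualSet P)
  rw [(hfin.isClosed_convexHull ℝ).closure_eq] at hkm
  exact hkm.symm
end

section
/- Let q₁, q₂, q₃ > 0 with q₁ + q₂ + q₃ = 1, let U = {x ∈ ℝ³ : q₁x₁ + q₂x₂ + q₃x₃ = 0}, and let P be the convex hull of {x ∈ ℤ³ : q₁x₁ + q₂x₂ + q₃x₃ = 0, xᵢ ≥ −1 for all i}. Then the origin 0 lies in the interior of P relative to the plane U if and only if (q₁, q₂, q₃) is a permutation of (1/3, 1/3, 1/3), (1/2, 1/4, 1/4), or (1/2, 1/3, 1/6). In other words, up to permutation, (1,1,1), (1,1,2) and (1,2,3) are the only IP weight systems with three weights. -/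
/-- The lattice points of the hyperplane orthogonal to `q` all of whose coordinates are at
least `-1`. -/
def weightLatticePoints {ι : Type*} [Fintype ι] (q : ι → ℝ) : Set (ι → ℝ) :=
  {x : ι → ℝ | (∀ i, ∃ m : ℤ, x i = (m : ℝ)) ∧ (∑ i, q i * x i = 0) ∧ ∀ i, -1 ≤ x i}

/-- No linear form which is not a multiple of `q` is minimal at `(1, …, 1)` among the natural
number vectors of weight one. -/
def HasNoSupportingForm {ι : Type*} [Fintype ι] (q : ι → ℝ) : Prop :=
  ∀ f : ι → ℝ, (∀ y : ι → ℕ, ∑ i, q i * y i = 1 → ∑ i, f i ≤ ∑ i, f i * y i) →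
    ∀ i j, f i * q j = f j * q i

theorem HasNoSupportingForm.comp_equiv {ι κ : Type*} [Fintype ι] [Fintype κ] {q : ι → ℝ}
    (h : HasNoSupportingForm q) (σ : κ ≃ ι) : HasNoSupportingForm (q ∘ σ) := by
  intro f hf i j
  have key := h (f ∘ σ.symm) (fun y hy => ?_) (σ i) (σ j)
  · simpa using key
  · have hy' : ∑ k, (q ∘ σ) k * ((y ∘ σ) k : ℝ) = 1 := by
      rw [← hy, ← Equiv.sum_comp σ]
      rfl
    have := hf (y ∘ σ) hy'
    rw [← Equiv.sum_comp σ (fun k => (f ∘ σ.symm) k),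
      ← Equiv.sum_comp σ (fun k => (f ∘ σ.symm) k * (y k : ℝ))]
    simpa using this

theorem hasNoSupportingForm_of_zero_mem_interior {ι : Type*} [Fintype ι] {q : ι → ℝ}
    (hsum : ∑ i, q i = 1)
    (h : (0 : ι → ℝ) ∈ Subtype.val '' (interior {x : {x : ι → ℝ // ∑ i, q i * x i = 0} |
      (x : ι → ℝ) ∈ convexHull ℝ (weightLatticePoints q)})) :
    HasNoSupportingForm q := by
  classical
  intro f hf i j
  obtain ⟨x₀, hx₀, hx₀0⟩ := h
  have hhull : convexHull ℝ (weightLatticePoints q) ⊆ {x | 0 ≤ ∑ k, f k * x k} := by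
    refine convexHull_min ?_ ?_
    · rintro x ⟨hint, hq, hge⟩
      choose m hm using hint
      have hm1 : ∀ k, 0 ≤ m k + 1 := fun k => by
        have := hge k
        rw [hm k] at this
        have : (-1 : ℤ) ≤ m k := by exact_mod_cast this
        lia
      have hcast : ∀ k, (((m k + 1).toNat : ℕ) : ℝ) = x k + 1 := fun k => by
        have : (((m k + 1).toNat : ℤ) : ℝ) = ((m k + 1 : ℤ) : ℝ) := by
          rw [Int.toNat_of_nonneg (hm1 k)]
        rw [hm k]
        exact_mod_cast this
      have := hf (fun k => (m k + 1).toNat) (by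
        simp only [hcast, mul_add, mul_one, Finset.sum_add_distrib, hq, hsum, zero_add])
      simp only [hcast, mul_add, mul_one, Finset.sum_add_distrib] at this
      simpa using this
    · refine convex_halfSpace_ge ⟨fun x y => ?_, fun c x => ?_⟩ 0
      · simp [mul_add, Finset.sum_add_distrib]
      · simp [Finset.mul_sum, mul_left_comm]
  set v : ι → ℝ := Pi.single i (q j) - Pi.single j (q i) with hv
  have hdot : ∀ g : ι → ℝ, ∑ k, g k * v k = g i * q j - g j * q i := fun g => by
    simp [hv, mul_sub, Finset.sum_sub_distrib, Pi.single_apply]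
  have hdot' : ∀ (g : ι → ℝ) (t : ℝ), ∑ k, g k * (t • v) k = t * (g i * q j - g j * q i) :=
    fun g t => by
      rw [← hdot, Finset.mul_sum]
      exact Finset.sum_congr rfl fun k _ => by simp [mul_left_comm]
  let φ : ℝ → {x : ι → ℝ // ∑ i, q i * x i = 0} :=
    fun t => ⟨t • v, by rw [hdot']; ring⟩
  have hφ : Continuous φ := by fun_prop
  have hφ0 : φ 0 = x₀ := Subtype.ext (by simp [φ, hx₀0])
  have hnhds := hφ.continuousAt.preimage_mem_nhds (x := 0)
    (by rw [hφ0]; exact mem_interior_iff_mem_nhds.mp hx₀)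
  obtain ⟨ε, hε, hball⟩ := Metric.mem_nhds_iff.mp hnhds
  have hpos : ∀ t : ℝ, |t| < ε → 0 ≤ t * (f i * q j - f j * q i) := fun t ht => by
    rw [← hdot']
    exact hhull (hball (by simpa using ht))
  have h₁ := hpos (ε / 2) (by rw [abs_of_pos (by positivity)]; linarith)
  have h₂ := hpos (-(ε / 2)) (by rw [abs_neg, abs_of_pos (by positivity)]; linarith)
  have h₃ : ε / 2 * (f i * q j - f j * q i) = 0 := by linarith
  rcases mul_eq_zero.mp h₃ with h₄ | h₄ <;> linarith

theorem zero_mem_interior_of_inv_nat {ι : Type*} [Fintype ι] {q : ι → ℝ}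
    (hpos : ∀ i, 0 < q i) (hsum : ∑ i, q i = 1) (hinv : ∀ i, ∃ n : ℕ, q i * n = 1) :
    (0 : ι → ℝ) ∈ Subtype.val '' (interior {x : {x : ι → ℝ // ∑ i, q i * x i = 0} |
      (x : ι → ℝ) ∈ convexHull ℝ (weightLatticePoints q)}) := by
  classical
  choose n hn using hinv
  refine ⟨⟨0, by simp⟩, ?_, rfl⟩
  refine mem_interior.mpr ⟨{x | ∀ i, -1 < (x : ι → ℝ) i}, ?_, ?_, by simp⟩
  · rintro ⟨x, hx⟩ hx1
    have hx1 : ∀ i, -1 < x i := hx1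
    have hw : ∑ i, q i * (x i + 1) = 1 := by
      simp [mul_add, Finset.sum_add_distrib, hx, hsum]
    have hcomb : x = ∑ i, (q i * (x i + 1)) • (Pi.single i (n i : ℝ) - 1 : ι → ℝ) := by
      ext k
      simp only [smul_sub, Finset.sum_sub_distrib, Pi.sub_apply, Finset.sum_apply,
        Pi.smul_apply, smul_eq_mul, Pi.one_apply, mul_one, hw]
      simp only [Pi.single_apply, mul_ite, mul_zero, Finset.sum_ite_eq, Finset.mem_univ, if_true]
      linear_combination -(x k + 1) * hn k
    change x ∈ convexHull ℝ (weightLatticePoints q)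
    rw [hcomb]
    refine (convex_convexHull ℝ _).sum_mem
      (fun i _ => mul_nonneg (hpos i).le (by linarith [hx1 i])) hw fun i _ => ?_
    refine subset_convexHull ℝ _ ⟨fun k => ⟨(Pi.single i (n i : ℤ) : ι → ℤ) k - 1, ?_⟩, ?_, ?_⟩
    · by_cases hk : k = i <;> simp [hk]
    · simp [mul_sub, Finset.sum_sub_distrib, hsum, Pi.single_apply, hn]
    · intro k
      by_cases hk : k = i <;> simp [hk]
  · simp only [Set.ofPred_forall]
    exact isOpen_iInter_of_finite fun i =>
      isOpen_lt continuous_const ((continuous_apply i).comp continuous_subtype_val)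

theorem HasNoSupportingForm.eq_third_or_exists_half {q : Fin 3 → ℝ} (hpos : ∀ i, 0 < q i)
    (hsum : ∑ i, q i = 1) (h : HasNoSupportingForm q) :
    q = ![1/3, 1/3, 1/3] ∨ ∃ i, q i = 1/2 := by
  by_contra! hne
  obtain ⟨hne, hhalf⟩ := hne
  have key := h 1 (fun y hy => ?_)
  · apply hne
    have h₁ := key 0 1
    have h₂ := key 0 2
    simp only [Pi.one_apply, one_mul] at h₁ h₂
    rw [Fin.sum_univ_three] at hsum
    ext i
    fin_cases i <;> simp <;> linarith
  · have h0 := hpos 0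
    have h1 := hpos 1
    have h2 := hpos 2
    have e0 := hhalf 0
    have e1 := hhalf 1
    have e2 := hhalf 2
    simp only [Fin.sum_univ_three, Pi.one_apply, one_mul] at *
    generalize y 0 = a at *
    generalize y 1 = b at *
    generalize y 2 = c at *
    by_contra! hlt
    have hlt : a + b + c < 3 := by
      have : ((a + b + c : ℕ) : ℝ) < (3 : ℕ) := by push_cast; linarith
      exact_mod_cast this
    have ha : a < 3 := by lia
    have hb : b < 3 := by lia
    have hc : c < 3 := by lia
    interval_cases a <;> interval_cases b <;> interval_cases c <;>
      first
      | lia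
      | (norm_num at hy <;> linarith)
      | exact e0 (by norm_num at hy; linarith)
      | exact e1 (by norm_num at hy; linarith)
      | exact e2 (by norm_num at hy; linarith)

theorem HasNoSupportingForm.eq_of_half {q : Fin 3 → ℝ} (hpos : ∀ i, 0 < q i)
    (hsum : ∑ i, q i = 1) (h : HasNoSupportingForm q) (hhalf : q 0 = 1/2) :
    q = ![1/2, 1/4, 1/4] ∨ q = ![1/2, 1/3, 1/6] ∨ q = ![1/2, 1/6, 1/3] := by
  have hext : ∀ b c : ℝ, q 1 = b → q 2 = c → q = ![1/2, b, c] := fun b c hb hc => by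
    ext i
    fin_cases i <;> simp [hb, hc, hhalf]
  by_contra! hne
  obtain ⟨hne₁, hne₂, hne₃⟩ := hne
  have h1 := hpos 1
  have h2 := hpos 2
  rw [Fin.sum_univ_three] at hsum
  have key := h ![2, 1, 1] (fun y hy => ?_)
  · have h₁ := key 1 2
    simp at h₁
    exact hne₁ (hext _ _ (by linarith) (by linarith))
  · have e1 : q 1 ≠ 1/3 := fun e => hne₂ (hext _ _ e (by linarith))
    have e2 : q 2 ≠ 1/3 := fun e => hne₃ (hext _ _ (by linarith) e)
    simp only [Fin.sum_univ_three, Matrix.cons_val, one_mul] at *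
    generalize y 0 = a at *
    generalize y 1 = b at *
    generalize y 2 = c at *
    by_contra! hlt
    have hlt : 2 * a + b + c < 4 := by
      have : ((2 * a + b + c : ℕ) : ℝ) < (4 : ℕ) := by push_cast; linarith
      exact_mod_cast this
    have ha : a < 2 := by lia
    have hb : b < 4 := by lia
    have hc : c < 4 := by lia
    interval_cases a <;> interval_cases b <;> interval_cases c <;>
      first
      | lia
      | (norm_num at hy <;> linarith)
      | exact e1 (by norm_num at hy; linarith)
      | exact e2 (by norm_num at hy; linarith)


/-- Up to permutation, `(1,1,1)`, `(1,1,2)` and `(1,2,3)` are the only IP weight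
systems with three weights. -/
theorem stmt_9 (q : Fin 3 → ℝ) (hpos : ∀ i, 0 < q i) (hsum : ∑ i, q i = 1) :
    ((0 : Fin 3 → ℝ) ∈ Subtype.val ''
      (interior {x : {x : Fin 3 → ℝ // ∑ i, q i * x i = 0} |
        (x : Fin 3 → ℝ) ∈ convexHull ℝ
          {x : Fin 3 → ℝ | (∀ i, ∃ m : ℤ, x i = (m : ℝ)) ∧
            (∑ i, q i * x i = 0) ∧ ∀ i, -1 ≤ x i}}))
    ↔ (∃ σ : Equiv.Perm (Fin 3),
        q ∘ σ = ![1/3, 1/3, 1/3] ∨ q ∘ σ = ![1/2, 1/4, 1/4] ∨ q ∘ σ = ![1/2, 1/3, 1/6]) := by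
  constructor
  · intro h
    have hform := hasNoSupportingForm_of_zero_mem_interior hsum h
    rcases hform.eq_third_or_exists_half hpos hsum with hq | ⟨i, hi⟩
    · exact ⟨1, Or.inl hq⟩
    · set σ : Equiv.Perm (Fin 3) := Equiv.swap 0 i with hσ
      rcases HasNoSupportingForm.eq_of_half (q := q ∘ σ) (fun k => hpos (σ k))
        ((Equiv.sum_comp σ q).trans hsum) (hform.comp_equiv σ) (by simp [hσ, hi]) with hq | hq | hq
      · exact ⟨σ, Or.inr (Or.inl hq)⟩
      · exact ⟨σ, Or.inr (Or.inr hq)⟩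
      · refine ⟨(Equiv.swap 1 2).trans σ, Or.inr (Or.inr ?_)⟩
        rw [Equiv.coe_trans, ← Function.comp_assoc, hq]
        ext k
        fin_cases k <;> simp [Equiv.swap_apply_def]
  · rintro ⟨σ, hσ⟩
    refine zero_mem_interior_of_inv_nat hpos hsum fun i => ?_
    obtain ⟨k, rfl⟩ := σ.surjective i
    change ∃ n : ℕ, (q ∘ σ) k * n = 1
    rcases hσ with hq | hq | hq <;> rw [hq] <;> fin_cases k
    exacts [⟨3, by norm_num⟩, ⟨3, by norm_num⟩, ⟨3, by norm_num⟩,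
      ⟨2, by norm_num⟩, ⟨4, by norm_num⟩, ⟨4, by norm_num⟩,
      ⟨2, by norm_num⟩, ⟨3, by norm_num⟩, ⟨6, by norm_num⟩]
end

section
/- Let D be an n×n diagonal matrix with positive integer diagonal entries D₁₁, …, D_nn. Then the assignment T ↦ T·ℤ^n (the subgroup of ℤ^n generated by the columns of T) is a bijection from the set of upper-triangular integer n×n matrices T satisfying (i) Tᵢᵢ > 0 for all i, (ii) 0 ≤ Tⱼᵢ < Tⱼⱼ for all j < i, and (iii) there exists an integer n×n matrix S with T·S = D, onto the set of subgroups M of ℤ^n with D·ℤ^n ⊆ M ⊆ ℤ^n. -/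
open Matrix in
/-- A lattice containing the image of one matrix in the image of another yields a factorization. -/
theorem Matrix.range_mulVecLin_le_iff_exists_mul_eq {n : ℕ} (D T : Matrix (Fin n) (Fin n) ℤ) :
    LinearMap.range D.mulVecLin ≤ LinearMap.range T.mulVecLin ↔
      ∃ S : Matrix (Fin n) (Fin n) ℤ, T * S = D := by
  constructor
  · intro h
    have hcol : ∀ j, ∃ c, T *ᵥ c = D.col j := fun j => by
      obtain ⟨c, hc⟩ := h ⟨Pi.single j 1, rfl⟩
      exact ⟨c, by simpa using hc⟩
    choose c hc using hcol
    refine ⟨(Matrix.of c)ᵀ, ?_⟩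
    ext i j
    exact congrFun (hc j) i
  · rintro ⟨S, rfl⟩
    rw [Matrix.mulVecLin_mul]
    exact LinearMap.range_comp_le_range _ _

/-- If the entries after `i` of a vector in the lattice generated by the columns of an upper
triangular matrix vanish, then its `i`-th entry is a multiple of the `i`-th diagonal entry. -/
theorem Matrix.diag_dvd_of_mem_range {n : ℕ} {T : Matrix (Fin n) (Fin n) ℤ}
    (htri : ∀ i j, j < i → T i j = 0) (hpos : ∀ i, 0 < T i i) {x : Fin n → ℤ}
    (hx : x ∈ LinearMap.range T.mulVecLin) {i : Fin n} (hxi : ∀ k, i < k → x k = 0) :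
    T i i ∣ x i := by
  obtain ⟨c, rfl⟩ := hx
  have hval : ∀ k, (∀ j, k < j → c j = 0) → T.mulVecLin c k = T k k * c k := by
    intro k hk
    rw [Matrix.mulVecLin_apply, Matrix.mulVec, dotProduct]
    refine Finset.sum_eq_single k (fun j _ hj => ?_) (by simp)
    rcases lt_or_gt_of_ne hj with h | h
    · rw [htri k j h, zero_mul]
    · rw [hk j h, mul_zero]
  have hc : ∀ k, i < k → c k = 0 := by
    intro k
    induction k using WellFoundedGT.induction with
    | ind k ih =>
      intro hk
      have h := hval k fun j hj => ih j hj (hk.trans hj)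
      rw [hxi k hk] at h
      exact (mul_eq_zero.mp h.symm).resolve_left (hpos k).ne'
  exact ⟨c i, hval i hc⟩

/-- An upper triangular matrix with columns in `M` whose diagonal entries divide all possible
leading entries of elements of `M` generates `M`. -/
theorem Matrix.range_mulVecLin_eq_of_diag_dvd {n : ℕ} {T : Matrix (Fin n) (Fin n) ℤ}
    (htri : ∀ i j, j < i → T i j = 0) {M : Submodule ℤ (Fin n → ℤ)}
    (hmem : ∀ i, T.col i ∈ M)
    (hdvd : ∀ i, ∀ x ∈ M, (∀ k, i < k → x k = 0) → T i i ∣ x i) :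
    LinearMap.range T.mulVecLin = M := by
  apply le_antisymm
  · rw [Matrix.range_mulVecLin, Submodule.span_le]
    rintro _ ⟨i, rfl⟩
    exact hmem i
  · have key : ∀ m ≤ n, ∀ x ∈ M, (∀ k : Fin n, m ≤ k → x k = 0) →
        x ∈ LinearMap.range T.mulVecLin := by
      intro m
      induction m with
      | zero =>
        intro _ x _ hx
        rw [show x = 0 from funext fun k => hx k (Nat.zero_le _)]
        exact zero_mem _
      | succ m ih =>
        intro hm x hxM hx
        let i : Fin n := ⟨m, hm⟩
        obtain ⟨a, ha⟩ := hdvd i x hxM fun k hk => hx k hk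
        have hcol : T.col i ∈ LinearMap.range T.mulVecLin := ⟨Pi.single i 1, by simp⟩
        have hsub : x - a • T.col i ∈ LinearMap.range T.mulVecLin := by
          refine ih (by omega) _ (M.sub_mem hxM (M.smul_mem a (hmem i))) fun k hk => ?_
          rcases hk.eq_or_lt with h | h
          · obtain rfl : i = k := Fin.ext h
            simp [ha, mul_comm]
          · simp [hx k h, htri k i h]
        simpa using add_mem hsub (Submodule.smul_mem _ a hcol)
    exact fun x hx => key n le_rfl x hx fun k hk => absurd k.isLt (by omega)

/-- Reduction of the first `m` entries of a lattice vector modulo the diagonal of a triangular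
family of lattice vectors. -/
theorem Submodule.exists_mem_reduced {n : ℕ} {M : Submodule ℤ (Fin n → ℤ)}
    {w : Fin n → Fin n → ℤ} (hw : ∀ i, w i ∈ M) (htri : ∀ i k, i < k → w i k = 0)
    (hpos : ∀ i, 0 < w i i) {m : ℕ} (hm : m ≤ n) {x : Fin n → ℤ} (hx : x ∈ M) :
    ∃ y ∈ M, (∀ k : Fin n, m ≤ k → y k = x k) ∧
      ∀ k : Fin n, (k : ℕ) < m → 0 ≤ y k ∧ y k < w k k := by
  induction m generalizing x with
  | zero => exact ⟨x, hx, fun _ _ => rfl, fun _ h => absurd h (Nat.not_lt_zero _)⟩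
  | succ m ih =>
    let i : Fin n := ⟨m, hm⟩
    obtain ⟨y, hyM, hy, hred⟩ :=
      ih (by omega) (M.sub_mem hx (M.smul_mem (x i / w i i) (hw i)))
    refine ⟨y, hyM, fun k hk => ?_, fun k hk => ?_⟩
    · rw [hy k (by omega)]
      simp [htri i k hk]
    · rcases (Nat.lt_succ_iff.mp hk).eq_or_lt with h | h
      · obtain rfl : k = i := Fin.ext h
        have hmod : y i = x i % w i i := by
          rw [hy i h.ge, Int.emod_def]
          simp [mul_comm]
        rw [hmod]
        exact ⟨Int.emod_nonneg _ (hpos i).ne', Int.emod_lt_of_pos _ (hpos i)⟩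
      · exact hred k h

/-- A lattice containing, for each `i`, a vector with positive `i`-th entry and vanishing later
entries contains such a vector whose `i`-th entry is minimal for divisibility. -/
theorem Submodule.exists_mem_leading_dvd {n : ℕ} {M : Submodule ℤ (Fin n → ℤ)} (i : Fin n)
    {d : Fin n → ℤ} (hd : d ∈ M) (hdi : 0 < d i) (htri : ∀ k, i < k → d k = 0) :
    ∃ w ∈ M, 0 < w i ∧ (∀ k, i < k → w k = 0) ∧
      ∀ x ∈ M, (∀ k, i < k → x k = 0) → w i ∣ x i := by
  classical
  have hex : ∃ a : ℕ, 0 < a ∧ ∃ w ∈ M, w i = a ∧ ∀ k, i < k → w k = 0 :=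
    ⟨(d i).toNat, by omega, d, hd, by omega, htri⟩
  obtain ⟨ha, w, hwM, hwi, hw⟩ := Nat.find_spec hex
  refine ⟨w, hwM, by omega, hw, fun x hxM hx => ?_⟩
  have hwpos : 0 < w i := by omega
  by_contra hndvd
  have hlt := Int.emod_lt_of_pos (x i) hwpos
  have hnn := Int.emod_nonneg (x i) hwpos.ne'
  have hne : x i % w i ≠ 0 := fun h => hndvd (Int.dvd_of_emod_eq_zero h)
  refine Nat.find_min hex (m := (x i % w i).toNat) (by omega)
    ⟨by omega, x - (x i / w i) • w, M.sub_mem hxM (M.smul_mem _ hwM), ?_, fun k hk => ?_⟩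
  · rw [Int.toNat_of_nonneg hnn, Int.emod_def]
    simp [mul_comm]
  · simp [hx k hk, hw k hk]

/-- Reduced upper triangular matrices generating the same lattice are equal. -/
theorem Matrix.eq_of_range_mulVecLin_eq_of_reduced {n : ℕ} {T U : Matrix (Fin n) (Fin n) ℤ}
    (hT : ∀ i j, j < i → T i j = 0) (hTpos : ∀ i, 0 < T i i)
    (hTred : ∀ j i, j < i → 0 ≤ T j i ∧ T j i < T j j)
    (hU : ∀ i j, j < i → U i j = 0) (hUpos : ∀ i, 0 < U i i)
    (hUred : ∀ j i, j < i → 0 ≤ U j i ∧ U j i < U j j)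
    (h : LinearMap.range T.mulVecLin = LinearMap.range U.mulVecLin) : T = U := by
  have hTcol : ∀ i, T.col i ∈ LinearMap.range T.mulVecLin := fun i => ⟨Pi.single i 1, by simp⟩
  have hUcol : ∀ i, U.col i ∈ LinearMap.range U.mulVecLin := fun i => ⟨Pi.single i 1, by simp⟩
  have hdiag : ∀ i, T i i = U i i := fun i =>
    Int.dvd_antisymm (hTpos i).le (hUpos i).le
      (diag_dvd_of_mem_range (x := U.col i) hT hTpos (h ▸ hUcol i) fun k hk => hU k i hk)
      (diag_dvd_of_mem_range (x := T.col i) hU hUpos (h ▸ hTcol i) fun k hk => hT k i hk)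
  ext k i
  induction k using WellFoundedGT.induction with
  | ind k ih =>
    rcases lt_trichotomy k i with hki | rfl | hki
    · have hdvd : T k k ∣ T k i - U k i :=
        diag_dvd_of_mem_range (x := T.col i - U.col i) hT hTpos
          (sub_mem (hTcol i) (h ▸ hUcol i)) fun j hj => sub_eq_zero.mpr (ih j hj)
      have := hTred k i hki
      have := hUred k i hki
      have := hdiag k
      exact sub_eq_zero.mp
        (Int.eq_zero_of_abs_lt_dvd hdvd (abs_lt.mpr ⟨by omega, by omega⟩))
    · exact hdiag k
    · rw [hT k i hki, hU k i hki]


/-- Lemma 7 (lattice part): for a diagonal integer matrix `D` with positive diagonal,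
`T ↦ T·ℤ^n` is a bijection from the set of upper-triangular integer matrices `T` with
positive diagonal, `0 ≤ Tⱼᵢ < Tⱼⱼ` above the diagonal, and `T·S = D` for some integer
`S`, onto the set of subgroups `M` of `ℤ^n` with `D·ℤ^n ⊆ M ⊆ ℤ^n`. -/
theorem stmt_10 (n : ℕ) (D : Matrix (Fin n) (Fin n) ℤ)
    (hdiag : ∀ i j, i ≠ j → D i j = 0) (hpos : ∀ i, 0 < D i i) :
    Set.BijOn (fun T : Matrix (Fin n) (Fin n) ℤ => LinearMap.range (Matrix.mulVecLin T))
      {T : Matrix (Fin n) (Fin n) ℤ |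
        (∀ i j, j < i → T i j = 0) ∧
        (∀ i, 0 < T i i) ∧
        (∀ j i, j < i → 0 ≤ T j i ∧ T j i < T j j) ∧
        (∃ S : Matrix (Fin n) (Fin n) ℤ, T * S = D)}
      {M : Submodule ℤ (Fin n → ℤ) | LinearMap.range (Matrix.mulVecLin D) ≤ M} := by
  refine ⟨?_, ?_, ?_⟩
  · rintro T ⟨-, -, -, hS⟩
    exact (Matrix.range_mulVecLin_le_iff_exists_mul_eq D T).mpr hS
  · rintro T ⟨hT, hTpos, hTred, -⟩ U ⟨hU, hUpos, hUred, -⟩ h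
    exact Matrix.eq_of_range_mulVecLin_eq_of_reduced hT hTpos hTred hU hUpos hUred h
  · intro M hM
    have hDcol : ∀ i, D.col i ∈ M := fun i => hM ⟨Pi.single i 1, by simp⟩
    choose w hwM hwpos hwtri hwdvd using fun i =>
      Submodule.exists_mem_leading_dvd i (hDcol i) (hpos i) fun k hk => hdiag k i hk.ne'
    choose t htM hteq htred using fun i : Fin n =>
      Submodule.exists_mem_reduced hwM hwtri hwpos i.isLt.le (hwM i)
    have htri : ∀ i j, j < i → t j i = 0 := fun i j hji => by
      rw [hteq j i hji.le, hwtri j i hji]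
    have htdiag : ∀ i, t i i = w i i := fun i => hteq i i le_rfl
    have hrange : LinearMap.range (Matrix.mulVecLin (Matrix.of t).transpose) = M := by
      refine Matrix.range_mulVecLin_eq_of_diag_dvd htri htM fun i x hx hxi => ?_
      rw [htdiag i]
      exact hwdvd i x hx hxi
    refine ⟨(Matrix.of t).transpose, ⟨htri, fun i => ?_, fun j i hji => ?_, ?_⟩, hrange⟩
    · change 0 < t i i
      rw [htdiag i]
      exact hwpos i
    · change 0 ≤ t i j ∧ t i j < t j j
      rw [htdiag j]
      exact htred i j hji
    · rw [← Matrix.range_mulVecLin_le_iff_exists_mul_eq, hrange]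
      exact hM
end

section
/- Let n₁, …, n_k be positive integers, U = {x ∈ ℝ^k : Σᵢ nᵢxᵢ = 0}, M = U ∩ ℤ^k, and Δ = {x ∈ U : xᵢ ≥ −1 for all i}. Fix l ∈ {1, …, k} and let y ∈ M satisfy y_l = −1 and yᵢ ≥ 0 for all i ≠ l (equivalently, (yᵢ)_{i≠l} is a nonnegative integer solution of Σ_{i≠l} nᵢyᵢ = n_l). Define π_y : U → U by π_y(x) = x + (x_l + 1)·y. Then: (1) π_y ∘ π_y = π_y and π_y(U) = U ∩ {x : x_l = −1}; (2) π_y(M) ⊆ M ∩ {x : x_l = −1}; (3) π_y(Δ) = Δ ∩ {x : x_l = −1}; and (4) y = π_y(0) lies in the relative interior of the facet Δ ∩ {x : x_l = −1}. -/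
theorem mem_intrinsicInterior_of_isOpen {E : Type*} [NormedAddCommGroup E] [NormedSpace ℝ E]
    {s V : Set E} {y : E} (hV : IsOpen V) (hyV : y ∈ V) (hys : y ∈ s)
    (h : ∀ x ∈ affineSpan ℝ s, x ∈ V → x ∈ s) : y ∈ intrinsicInterior ℝ s := by
  refine mem_intrinsicInterior.2 ⟨⟨y, subset_affineSpan ℝ s hys⟩, ?_, rfl⟩
  exact mem_interior.2 ⟨Subtype.val ⁻¹' V, fun x hx => h x x.2 hx,
    hV.preimage continuous_subtype_val, hyV⟩

/-- The affine subspace of a coordinate slice of the hyperplane `∑ i, w i * x i = 0`. -/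
def hyperplaneSlice {ι : Type*} [Fintype ι] (w : ι → ℝ) (l : ι) (c : ℝ) :
    AffineSubspace ℝ (ι → ℝ) where
  carrier := {x | ∑ i, w i * x i = 0 ∧ x l = c}
  smul_vsub_vadd_mem' := by
    rintro t p q r ⟨hp, hpl⟩ ⟨hq, hql⟩ ⟨hr, hrl⟩
    refine ⟨?_, by simp [hpl, hql, hrl]⟩
    have : ∑ i, w i * (t • (p -ᵥ q) +ᵥ r) i
        = t * (∑ i, w i * p i - ∑ i, w i * q i) + ∑ i, w i * r i := by
      rw [← Finset.sum_sub_distrib, Finset.mul_sum, ← Finset.sum_add_distrib]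
      refine Finset.sum_congr rfl fun i _ => ?_
      simp only [vsub_eq_sub, vadd_eq_add, Pi.add_apply, Pi.smul_apply, Pi.sub_apply, smul_eq_mul]
      ring
    rw [this, hp, hq, hr]
    ring


/-- Lemma 10 (b), (c): properties of the projection `π_y(x) = x + (x_l + 1)·y`
associated to a partition `y` of the weight `n_l` by the remaining weights. -/
theorem stmt_18 (k : ℕ) (nw : Fin k → ℤ) (hpos : ∀ i, 0 < nw i)
    (l : Fin k) (y : Fin k → ℝ)
    (hyU : ∑ i, (nw i : ℝ) * y i = 0) (hylat : ∀ i, ∃ m : ℤ, y i = (m : ℝ))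
    (hyl : y l = -1) (hynn : ∀ i, i ≠ l → 0 ≤ y i) :
    let U : Set (Fin k → ℝ) := {x | ∑ i, (nw i : ℝ) * x i = 0}
    let M : Set (Fin k → ℝ) := {x ∈ U | ∀ i, ∃ m : ℤ, x i = (m : ℝ)}
    let Δ : Set (Fin k → ℝ) := {x ∈ U | ∀ i, -1 ≤ x i}
    let π : (Fin k → ℝ) → (Fin k → ℝ) := fun x => x + (x l + 1) • y
    (∀ x ∈ U, π (π x) = π x) ∧
    π '' U = U ∩ {x | x l = -1} ∧
    π '' M ⊆ M ∩ {x | x l = -1} ∧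
    π '' Δ = Δ ∩ {x | x l = -1} ∧
    y = π 0 ∧ y ∈ intrinsicInterior ℝ (Δ ∩ {x | x l = -1}) := by
  intro U M Δ π
  have hπU : ∀ x ∈ U, π x ∈ U := by
    intro x hx
    have hx' : ∑ i, (nw i : ℝ) * x i = 0 := hx
    have : ∑ i, (nw i : ℝ) * π x i
        = ∑ i, (nw i : ℝ) * x i + (x l + 1) * ∑ i, (nw i : ℝ) * y i := by
      rw [Finset.mul_sum, ← Finset.sum_add_distrib]
      refine Finset.sum_congr rfl fun i _ => ?_
      simp only [π, Pi.add_apply, Pi.smul_apply, smul_eq_mul]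
      ring
    change ∑ i, (nw i : ℝ) * π x i = 0
    rw [this, hx', hyU]
    ring
  have hπl : ∀ x, π x l = -1 := by
    intro x
    simp [π, hyl]
  have hfix : ∀ x : Fin k → ℝ, x l = -1 → π x = x := by
    intro x hx
    simp [π, hx]
  refine ⟨fun x _ => hfix _ (hπl x), ?_, ?_, ?_, by simp [π], ?_⟩
  · ext x
    constructor
    · rintro ⟨z, hz, rfl⟩
      exact ⟨hπU z hz, hπl z⟩
    · rintro ⟨hx, hxl⟩
      exact ⟨x, hx, hfix x hxl⟩
  · rintro _ ⟨z, ⟨hz, hzi⟩, rfl⟩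
    refine ⟨⟨hπU z hz, fun i => ?_⟩, hπl z⟩
    obtain ⟨a, ha⟩ := hzi i
    obtain ⟨b, hb⟩ := hzi l
    obtain ⟨c, hc⟩ := hylat i
    exact ⟨a + (b + 1) * c, by simp [π, ha, hb, hc]⟩
  · ext x
    constructor
    · rintro ⟨z, ⟨hz, hzi⟩, rfl⟩
      refine ⟨⟨hπU z hz, fun i => ?_⟩, hπl z⟩
      by_cases hi : i = l
      · rw [hi, hπl]
      · have h₁ : 0 ≤ (z l + 1) * y i := mul_nonneg (by linarith [hzi l]) (hynn i hi)
        have h₂ : π z i = z i + (z l + 1) * y i := rfl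
        linarith [hzi i]
    · rintro ⟨hx, hxl⟩
      exact ⟨x, hx, hfix x hxl⟩
  · have hV : IsOpen {x : Fin k → ℝ | ∀ i, i ≠ l → -1 < x i} := by
      simp only [Set.ofPred_forall]
      exact isOpen_iInter_of_finite fun i => isOpen_iInter_of_finite fun _ =>
        isOpen_lt continuous_const (continuous_apply i)
    refine mem_intrinsicInterior_of_isOpen hV (fun i hi => by linarith [hynn i hi])
      ⟨⟨hyU, fun i => ?_⟩, hyl⟩ fun x hx hxV => ?_
    · by_cases hi : i = l
      · rw [hi, hyl]
      · linarith [hynn i hi]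
    · have hle : affineSpan ℝ (Δ ∩ {x | x l = -1})
          ≤ hyperplaneSlice (fun i => (nw i : ℝ)) l (-1) :=
        affineSpan_le.2 fun z hz => ⟨hz.1.1, hz.2⟩
      obtain ⟨hxU, hxl⟩ := hle hx
      refine ⟨⟨hxU, fun i => ?_⟩, hxl⟩
      by_cases hi : i = l
      · rw [hi, hxl]
      · exact (hxV i hi).le
end
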